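/- arXiv:1608.03937 — 2 statements merged into one kernel-verified Lean document; each statement's English description precedes it below -/
import Mathlib

section
/- For all integers g ≥ 0 and r ≥ 1 with 2 − 2g − r < 0, there exists a connected trivalent fat graph (H, ι, σ) of genus g with exactly r boundary components whose vertex set admits an independent set consisting of exactly half of the vertices; that is, there is a set W of σ-orbits with #W = (#vertices)/2 such that no half-edge h ∈ H has both the σ-orbit of h and the σ-orbit of ι(h) belonging to W. -/
/-- The setoid on a type `H` whose equivalence classes are the cycles (orbits) of a
permutation `σ` of `H`. -/
def cycleSetoid {H : Type*} (σ : Equiv.Perm H) : Setoid H :=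
  ⟨σ.SameCycle,
    ⟨fun x => Equiv.Perm.SameCycle.refl σ x, fun h => h.symm, fun h₁ h₂ => h₁.trans h₂⟩⟩


/-- A cyclic labelling computes the number of cycles. -/
theorem card_of_label {E : Type} {Q : Type} (c : Equiv.Perm E) (l : E → Q)
    (hinv : ∀ x, l (c x) = l x) (hsurj : Function.Surjective l)
    (hsep : ∀ x y, l x = l y → c.SameCycle x y) :
    Nat.card (Quotient (cycleSetoid c)) = Nat.card Q := by
  have hz : ∀ x y, c.SameCycle x y → l x = l y := by
    rintro x y ⟨n, rfl⟩
    have hp : ∀ (m : ℕ) x, l ((c ^ m) x) = l x := by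
      intro m
      induction m with
      | zero => intro x; simp
      | succ m ih => intro x; rw [pow_succ', Equiv.Perm.mul_apply, hinv, ih]
    obtain ⟨m, rfl | rfl⟩ := n.eq_nat_or_neg
    · rw [zpow_natCast, hp]
    · have := hp m ((c ^ (-(m : ℤ))) x)
      rw [← this, ← zpow_natCast, ← Equiv.Perm.mul_apply, ← zpow_add]
      simp
  refine Nat.card_eq_of_bijective
    (Quotient.lift (s := cycleSetoid c) l (fun x y h => hz x y h)) ⟨?_, ?_⟩
  · intro x y
    induction x using Quotient.inductionOn
    induction y using Quotient.inductionOn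
    intro h
    exact Quotient.sound (s := cycleSetoid c) (hsep _ _ h)
  · intro q
    obtain ⟨x, rfl⟩ := hsurj q
    exact ⟨Quotient.mk (cycleSetoid c) x, rfl⟩

/-- Only one class under two permutations. -/
def Conn {E : Type} (a b : Equiv.Perm E) : Prop :=
  ∀ p : E → Prop, (∀ x, p (a x) ↔ p x) → (∀ x, p (b x) ↔ p x) → ∀ x y, p x → p y

theorem sameCycle_invariant {E : Type} (c : Equiv.Perm E) (p : E → Prop)
    (hp : ∀ x, p (c x) ↔ p x) {x y : E} (h : c.SameCycle x y) : p x ↔ p y := by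
  obtain ⟨n, rfl⟩ := h
  have hn : ∀ (m : ℕ) x, p ((c ^ m) x) ↔ p x := by
    intro m
    induction m with
    | zero => intro x; simp
    | succ m ih => intro x; rw [pow_succ', Equiv.Perm.mul_apply, hp, ih]
  obtain ⟨m, rfl | rfl⟩ := n.eq_nat_or_neg
  · rw [zpow_natCast, hn]
  · have := hn m ((c ^ (-(m : ℤ))) x)
    rw [← this, ← zpow_natCast, ← Equiv.Perm.mul_apply, ← zpow_add]
    simp

/-- A bipartite cubic fat graph with `2 k` vertices and `r` boundary components. -/
structure Good (E : Type) (a b : Equiv.Perm E) (k r : ℕ) : Prop where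
  fin : Finite E
  card : Nat.card E = 3 * k
  ne : Nonempty E
  fa : ∀ x, a x ≠ x
  fb : ∀ x, b x ≠ x
  a3 : ∀ x, a (a (a x)) = x
  b3 : ∀ x, b (b (b x)) = x
  conn : Conn a b
  faces : Nat.card (Quotient (cycleSetoid (a * b))) = r

open Classical in
theorem glue {E F Z : Type} [Finite F] [Finite Z] {a b : Equiv.Perm E} {k r : ℕ}
    (hE : Good E a b k r) (a2 b2 : Equiv.Perm F) (k2 : ℕ) (hF : Nat.card F = 3 * k2)
    (fa2 : ∀ x, a2 x ≠ x) (fb2 : ∀ x, b2 x ≠ x) (a23 : ∀ x, a2 (a2 (a2 x)) = x)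
    (b23 : ∀ x, b2 (b2 (b2 x)) = x) (conn2 : Conn a2 b2)
    (L : F → Bool ⊕ Z) (hLinv : ∀ x, L (a2 (b2 x)) = L x)
    (hLsep : ∀ x y, L x = L y → ∃ n : ℕ, (fun z => a2 (b2 z))^[n] x = y)
    (hLsurj : ∀ z : Z, ∃ x, L x = Sum.inr z)
    (f g : F) (hg : b2 g = f) (hLf : L f = Sum.inl true) (hLg : L g = Sum.inl false) :
    ∃ (E' : Type) (a' b' : Equiv.Perm E'), Good E' a' b' (k + k2) (r + Nat.card Z) := by
  obtain ⟨e⟩ := hE.ne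
  have := hE.fin
  obtain ⟨d, hd⟩ : ∃ d, b d = e := b.surjective e
  have hde : d ≠ e := by rintro rfl; exact hE.fb _ hd
  have hgf : g ≠ f := by rintro rfl; exact fb2 _ hg
  set s : Equiv.Perm (E ⊕ F) := Equiv.swap (Sum.inl e) (Sum.inr f) with hs
  have ss : ∀ x, s (s x) = x := fun x => by simp [hs]
  have se : s (Sum.inl e) = Sum.inr f := by simp [hs]
  have sf : s (Sum.inr f) = Sum.inl e := by simp [hs]
  have sl : ∀ x, x ≠ e → s (Sum.inl x) = Sum.inl x := fun x hx => by
    apply Equiv.swap_apply_of_ne_of_ne <;> simp [hx]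
  have sr : ∀ x, x ≠ f → s (Sum.inr x) = Sum.inr x := fun x hx => by
    apply Equiv.swap_apply_of_ne_of_ne <;> simp [hx]
  set A : Equiv.Perm (E ⊕ F) := Equiv.sumCongr a a2 with hA
  set B : Equiv.Perm (E ⊕ F) := s * Equiv.sumCongr b b2 * s with hB
  have Al : ∀ x, A (Sum.inl x) = Sum.inl (a x) := fun x => rfl
  have Ar : ∀ x, A (Sum.inr x) = Sum.inr (a2 x) := fun x => rfl
  have Be : B (Sum.inl e) = Sum.inr (b2 f) := by
    simp only [hB, Equiv.Perm.mul_apply, se, Equiv.sumCongr_apply, Sum.map_inr]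
    exact sr _ (fb2 f)
  have Bf : B (Sum.inr f) = Sum.inl (b e) := by
    simp only [hB, Equiv.Perm.mul_apply, sf, Equiv.sumCongr_apply, Sum.map_inl]
    exact sl _ (hE.fb e)
  have Bd : B (Sum.inl d) = Sum.inr f := by
    simp only [hB, Equiv.Perm.mul_apply, sl d hde, Equiv.sumCongr_apply, Sum.map_inl, hd, se]
  have Bg : B (Sum.inr g) = Sum.inl e := by
    simp only [hB, Equiv.Perm.mul_apply, sr g hgf, Equiv.sumCongr_apply, Sum.map_inr, hg, sf]
  have Bl : ∀ x, x ≠ e → x ≠ d → B (Sum.inl x) = Sum.inl (b x) := fun x h1 h2 => by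
    simp only [hB, Equiv.Perm.mul_apply, sl x h1, Equiv.sumCongr_apply, Sum.map_inl]
    exact sl _ (fun h => h2 (b.injective (h.trans hd.symm)))
  have Br : ∀ x, x ≠ f → x ≠ g → B (Sum.inr x) = Sum.inr (b2 x) := fun x h1 h2 => by
    simp only [hB, Equiv.Perm.mul_apply, sr x h1, Equiv.sumCongr_apply, Sum.map_inr]
    exact sr _ (fun h => h2 (b2.injective (h.trans hg.symm)))
  set C := A * B with hC
  have step : ∀ x y, A (B x) = y → C.SameCycle x y := fun x y h => by
    refine ⟨1, ?_⟩
    simpa [hC] using h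
  have stepr : ∀ y, y ≠ f → y ≠ g → C.SameCycle (Sum.inr y) (Sum.inr (a2 (b2 y))) :=
    fun y h1 h2 => step _ _ (by rw [Br y h1 h2, Ar])
  have pathf : ∀ (n : ℕ) y, L y = Sum.inl true → (fun z => a2 (b2 z))^[n] y = f →
      C.SameCycle (Sum.inr y) (Sum.inr f) := by
    intro n
    induction n with
    | zero => rintro y - h; simp at h; subst h; exact Equiv.Perm.SameCycle.refl _ _
    | succ n ih =>
      intro y hy h
      by_cases hyf : y = f
      · subst hyf; exact Equiv.Perm.SameCycle.refl _ _
      have hyg : y ≠ g := by rintro rfl; rw [hLg] at hy; simp at hy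
      exact (stepr y hyf hyg).trans (ih _ (by rw [hLinv, hy]) (by simpa using h))
  have pathg : ∀ (n : ℕ) y, L y = Sum.inl false → (fun z => a2 (b2 z))^[n] y = g →
      C.SameCycle (Sum.inr y) (Sum.inr g) := by
    intro n
    induction n with
    | zero => rintro y - h; simp at h; subst h; exact Equiv.Perm.SameCycle.refl _ _
    | succ n ih =>
      intro y hy h
      by_cases hyg : y = g
      · subst hyg; exact Equiv.Perm.SameCycle.refl _ _
      have hyf : y ≠ f := by rintro rfl; rw [hLf] at hy; simp at hy
      exact (stepr y hyf hyg).trans (ih _ (by rw [hLinv, hy]) (by simpa using h))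
  have pathz : ∀ (n : ℕ) y z w, L y = Sum.inr w → (fun z => a2 (b2 z))^[n] y = z →
      C.SameCycle (Sum.inr y) (Sum.inr z) := by
    intro n
    induction n with
    | zero => rintro y z w - h; simp at h; subst h; exact Equiv.Perm.SameCycle.refl _ _
    | succ n ih =>
      intro y z w hy h
      have hyf : y ≠ f := by rintro rfl; rw [hLf] at hy; simp at hy
      have hyg : y ≠ g := by rintro rfl; rw [hLg] at hy; simp at hy
      exact (stepr y hyf hyg).trans (ih _ _ w (by rw [hLinv, hy]) (by simpa using h))
  have toF : ∀ y, L y = Sum.inl true → C.SameCycle (Sum.inr y) (Sum.inr f) := fun y hy => by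
    obtain ⟨n, hn⟩ := hLsep y f (by rw [hy, hLf])
    exact pathf n y hy hn
  have toG : ∀ y, L y = Sum.inl false → C.SameCycle (Sum.inr y) (Sum.inr g) := fun y hy => by
    obtain ⟨n, hn⟩ := hLsep y g (by rw [hy, hLg])
    exact pathg n y hy hn
  have ef : C.SameCycle (Sum.inl e) (Sum.inr f) :=
    (step _ (Sum.inr (a2 (b2 f))) (by rw [Be, Ar])).trans (toF _ (by rw [hLinv, hLf]))
  have dg : C.SameCycle (Sum.inl d) (Sum.inr g) :=
    (step _ (Sum.inr (a2 (b2 g))) (by rw [Bd, Ar, hg])).trans (toG _ (by rw [hLinv, hLg]))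
  have stepl : ∀ x, C.SameCycle (Sum.inl x) (Sum.inl (a (b x))) := by
    intro x
    by_cases h1 : x = e
    · subst h1
      exact ef.trans (step _ _ (by rw [Bf, Al]))
    by_cases h2 : x = d
    · subst h2
      exact dg.trans (step _ _ (by rw [Bg, Al, hd]))
    exact step _ _ (by rw [Bl x h1 h2, Al])
  have lift : ∀ x y, (a * b).SameCycle x y → C.SameCycle (Sum.inl x) (Sum.inl y) := by
    intro x y h
    refine (sameCycle_invariant (a * b)
      (fun z => C.SameCycle (Sum.inl x) (Sum.inl z)) ?_ h).1 (Equiv.Perm.SameCycle.refl _ _)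
    intro z
    exact ⟨fun h => h.trans (stepl z).symm, fun h => h.trans (stepl z)⟩
  refine ⟨E ⊕ F, A, B, inferInstance, ?_, ⟨Sum.inl e⟩, ?_, ?_, ?_, ?_, ?_, ?_⟩
  · rw [Nat.card_sum, hE.card, hF]; ring
  · rintro (x | x) h
    · exact hE.fa x (Sum.inl_injective h)
    · exact fa2 x (Sum.inr_injective h)
  · intro x h
    have h' : (Equiv.sumCongr b b2) (s x) = s x := by
      have := congrArg s h
      simpa only [hB, Equiv.Perm.mul_apply, ss] using this
    generalize s x = y at h'
    rcases y with y | y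
    · exact hE.fb y (Sum.inl_injective h')
    · exact fb2 y (Sum.inr_injective h')
  · rintro (x | x)
    · simp only [Al, hE.a3]
    · simp only [Ar, a23]
  · intro x
    simp only [hB, Equiv.Perm.mul_apply, ss]
    have : ∀ y, (Equiv.sumCongr b b2) ((Equiv.sumCongr b b2) ((Equiv.sumCongr b b2) y)) = y := by
      rintro (y | y)
      · simp [hE.b3]
      · simp [b23]
    rw [this, ss]
  · intro p pa pb
    have pc : ∀ x, p (C x) ↔ p x := fun x => by
      rw [hC, Equiv.Perm.mul_apply, pa, pb]
    have pef := sameCycle_invariant C p pc ef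
    have cE := hE.conn (fun x => p (Sum.inl x)) (fun x => by rw [← Al, pa]) (fun x => by
      by_cases h1 : x = e
      · subst h1; rw [← Bf, pb, pef]
      by_cases h2 : x = d
      · subst h2; rw [hd, pef, ← Bd, pb]
      rw [← Bl x h1 h2, pb])
    have cF := conn2 (fun x => p (Sum.inr x)) (fun x => by rw [← Ar, pa]) (fun x => by
      by_cases h1 : x = f
      · subst h1; rw [← Be, pb, pef]
      by_cases h2 : x = g
      · subst h2; rw [hg, ← pef, ← Bg, pb]
      rw [← Br x h1 h2, pb])
    have toe : ∀ x, p x → p (Sum.inl e) := by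
      rintro (x | x) h
      · exact cE x e h
      · exact pef.2 (cF x f h)
    have ofe : ∀ x, p (Sum.inl e) → p x := by
      rintro (x | x) h
      · exact cE e x h
      · exact cF f x (pef.1 h)
    exact fun x y h => ofe y (toe x h)
  · let q : E → Quotient (cycleSetoid (a * b)) := Quotient.mk _
    have hq : ∀ x, q (a (b x)) = q x := fun x =>
      Quotient.sound (s := cycleSetoid (a * b))
        (Equiv.Perm.SameCycle.symm ⟨1, by simp⟩)
    let M : Bool ⊕ Z → Quotient (cycleSetoid (a * b)) ⊕ Z := fun t =>
      match t with
      | Sum.inl true => Sum.inl (q e)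
      | Sum.inl false => Sum.inl (q d)
      | Sum.inr z => Sum.inr z
    let l : E ⊕ F → Quotient (cycleSetoid (a * b)) ⊕ Z :=
      Sum.elim (fun x => Sum.inl (q x)) (fun y => M (L y))
    rw [card_of_label C l]
    · rw [Nat.card_sum, hE.faces]
    · rintro (x | x)
      · rw [hC, Equiv.Perm.mul_apply]
        by_cases h1 : x = e
        · subst h1
          rw [Be, Ar]; simp [l, hLinv, hLf, M]
        by_cases h2 : x = d
        · subst h2
          rw [Bd, Ar, ← hg]; simp [l, hLinv, hLg, M]
        rw [Bl x h1 h2, Al]; simp [l, hq]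
      · rw [hC, Equiv.Perm.mul_apply]
        by_cases h1 : x = f
        · subst h1
          rw [Bf, Al]; simp [l, hLf, M, hq]
        by_cases h2 : x = g
        · subst h2
          rw [Bg, Al, ← hd]; simp [l, hLg, M, hq]
        rw [Br x h1 h2, Ar]; simp [l, hLinv]
    · rintro (t | z)
      · obtain ⟨x, rfl⟩ := Quotient.exists_rep t
        exact ⟨Sum.inl x, rfl⟩
      · obtain ⟨x, hx⟩ := hLsurj z
        exact ⟨Sum.inr x, by simp [l, hx, M]⟩
    · have key : ∀ x, (∃ y, C.SameCycle x (Sum.inl y) ∧ l x = Sum.inl (q y)) ∨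
          ∃ y z, x = Sum.inr y ∧ L y = Sum.inr z := by
        rintro (x | y)
        · exact Or.inl ⟨x, Equiv.Perm.SameCycle.refl _ _, rfl⟩
        · rcases hy : L y with (_ | _) | z
          · exact Or.inl ⟨d, (toG y hy).trans dg.symm, by simp [l, hy, M]⟩
          · exact Or.inl ⟨e, (toF y hy).trans ef.symm, by simp [l, hy, M]⟩
          · exact Or.inr ⟨y, z, rfl, hy⟩
      intro x y hxy
      rcases key x with ⟨x', hx, hx'⟩ | ⟨x', z, rfl, hx⟩ <;>
        rcases key y with ⟨y', hy, hy'⟩ | ⟨y', w, rfl, hy⟩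
      · rw [hx', hy'] at hxy
        have := Quotient.exact (s := cycleSetoid (a * b)) (Sum.inl_injective hxy)
        exact (hx.trans (lift _ _ this)).trans hy.symm
      · rw [hx'] at hxy; simp [l, hy, M] at hxy
      · rw [hy'] at hxy; simp [l, hx, M] at hxy
      · have : L x' = L y' := by
          have hzw : z = w := by simpa [l, hx, hy, M] using hxy
          rw [hx, hy, hzw]
        obtain ⟨n, hn⟩ := hLsep _ _ this
        exact pathz n _ _ z hx hn

/-- The cyclic rotation of three points. -/
def rot : Equiv.Perm (Fin 3) := ⟨![1, 2, 0], ![2, 0, 1], by decide, by decide⟩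

def pieceA : Equiv.Perm (Fin 6) :=
  ⟨![1, 2, 0, 4, 5, 3], ![2, 0, 1, 5, 3, 4], by decide, by decide⟩

def pieceB : Equiv.Perm (Fin 6) :=
  ⟨![1, 5, 3, 4, 2, 0], ![5, 0, 4, 2, 3, 1], by decide, by decide⟩

theorem conn_rot (b : Equiv.Perm (Fin 3)) : Conn rot b := by
  intro p pa pb
  have h0 : p 1 ↔ p 0 := pa 0
  have h1 : p 2 ↔ p 1 := pa 1
  intro x y
  fin_cases x <;> fin_cases y <;> simp <;> tauto

theorem conn_piece : Conn pieceA pieceB := by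
  intro p pa pb
  have h0 : p 1 ↔ p 0 := pa 0
  have h1 : p 2 ↔ p 1 := pa 1
  have h3 : p 4 ↔ p 3 := pa 3
  have h4 : p 5 ↔ p 4 := pa 4
  have h5 : p 0 ↔ p 5 := pb 5
  intro x y
  fin_cases x <;> fin_cases y <;> simp <;> tauto

theorem moveA {E : Type} {a b : Equiv.Perm E} {k r : ℕ} (h : Good E a b k r) :
    ∃ (E' : Type) (a' b' : Equiv.Perm E'), Good E' a' b' (k + 1) (r + 1) := by
  have := glue (Z := Unit) h rot rot⁻¹ 1 (by simp) (by decide) (by decide) (by decide)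
    (by decide) (conn_rot _) ![Sum.inl true, Sum.inl false, Sum.inr ()] (by decide)
    (fun x y hxy => ⟨0, by revert x y; decide⟩) (fun z => ⟨2, rfl⟩) 0 1 (by decide) rfl rfl
  simpa using this

theorem moveB {E : Type} {a b : Equiv.Perm E} {k r : ℕ} (h : Good E a b k r) :
    ∃ (E' : Type) (a' b' : Equiv.Perm E'), Good E' a' b' (k + 2) r := by
  have hs : ∀ x y : Fin 6, (![Sum.inl true, Sum.inl false, Sum.inl true, Sum.inl false,
      Sum.inl true, Sum.inl false] : Fin 6 → Bool ⊕ Empty) x = (![Sum.inl true, Sum.inl false,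
      Sum.inl true, Sum.inl false, Sum.inl true, Sum.inl false] : Fin 6 → Bool ⊕ Empty) y →
      ∃ n : Fin 3, (fun z => pieceA (pieceB z))^[n.1] x = y := by decide
  have := glue (Z := Empty) h pieceA pieceB 2 (by simp) (by decide) (by decide) (by decide)
    (by decide) conn_piece _ (by decide)
    (fun x y hxy => (hs x y hxy).imp' Fin.val (fun _ h => h)) (fun z => z.elim) 0 5
    (by decide) rfl rfl
  simpa using this

theorem base3 : Good (Fin 3) rot rot⁻¹ 1 3 where
  fin := inferInstance
  card := by simp
  ne := inferInstance
  fa := by decide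
  fb := by decide
  a3 := by decide
  b3 := by decide
  conn := conn_rot _
  faces := by
    rw [card_of_label _ (id : Fin 3 → Fin 3) (by simp) Function.surjective_id]
    · simp
    · rintro x y rfl; exact Equiv.Perm.SameCycle.refl _ _

theorem base1 : Good (Fin 3) rot rot 1 1 where
  fin := inferInstance
  card := by simp
  ne := inferInstance
  fa := by decide
  fb := by decide
  a3 := by decide
  b3 := by decide
  conn := conn_rot _
  faces := by
    rw [card_of_label _ (fun _ => () : Fin 3 → Unit) (by simp) (fun _ => ⟨0, rfl⟩)]
    · simp
    · have : ∀ x y : Fin 3, ∃ n : Fin 3, ((rot * rot) ^ n.1) x = y := by decide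
      intro x y _
      obtain ⟨n, hn⟩ := this x y
      exact ⟨(n.1 : ℤ), by simpa using hn⟩

theorem moveA_iter (n : ℕ) : ∀ {E : Type} {a b : Equiv.Perm E} {k r : ℕ}, Good E a b k r →
    ∃ (E' : Type) (a' b' : Equiv.Perm E'), Good E' a' b' (k + n) (r + n) := by
  induction n with
  | zero => intro E a b k r h; exact ⟨E, a, b, h⟩
  | succ n ih =>
    intro E a b k r h
    obtain ⟨E', a', b', h'⟩ := ih h
    exact moveA h'

theorem moveB_iter (n : ℕ) : ∀ {E : Type} {a b : Equiv.Perm E} {k r : ℕ}, Good E a b k r →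
    ∃ (E' : Type) (a' b' : Equiv.Perm E'), Good E' a' b' (k + 2 * n) r := by
  induction n with
  | zero => intro E a b k r h; exact ⟨E, a, b, h⟩
  | succ n ih =>
    intro E a b k r h
    obtain ⟨E', a', b', h'⟩ := ih h
    exact moveB h'

theorem exists_good (g r : ℕ) (hr : 1 ≤ r) (hχ : (2 : ℤ) - 2 * (g : ℤ) - (r : ℤ) < 0) :
    ∃ (k : ℕ) (E : Type) (a b : Equiv.Perm E), Good E a b k r ∧ k + 2 = 2 * g + r := by
  rcases g with _ | g
  · obtain ⟨n, rfl⟩ : ∃ n, r = 3 + n := ⟨r - 3, by omega⟩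
    obtain ⟨E, a, b, h⟩ := moveA_iter n base3
    exact ⟨_, E, a, b, h, by omega⟩
  · obtain ⟨n, rfl⟩ : ∃ n, r = 1 + n := ⟨r - 1, by omega⟩
    obtain ⟨_, _, _, h0⟩ := moveB_iter g base1
    obtain ⟨E, a, b, h⟩ := moveA_iter n h0
    exact ⟨_, E, a, b, h, by omega⟩

theorem card_quot {H : Type} [Finite H] (σ : Equiv.Perm H) (n : ℕ)
    (h : ∀ x : H, Nat.card {y : H // σ.SameCycle x y} = n) :
    n * Nat.card (Quotient (cycleSetoid σ)) = Nat.card H := by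
  classical
  have := Fintype.ofFinite (Quotient (cycleSetoid σ))
  rw [← Nat.card_congr (Equiv.sigmaFiberEquiv (Quotient.mk (cycleSetoid σ))), Nat.card_sigma]
  rw [Finset.sum_congr rfl (g := fun _ => n)]
  · simp [mul_comm]
  · intro q _
    induction q using Quotient.inductionOn with
    | h x =>
      rw [← h x]
      refine Nat.card_congr (Equiv.subtypeEquivRight fun y => ?_)
      exact ⟨fun e => (Quotient.exact (s := cycleSetoid σ) e).symm,
        fun e => Quotient.sound (s := cycleSetoid σ) e.symm⟩

theorem card_cycle3 {H : Type} (σ : Equiv.Perm H) (hf : ∀ x, σ x ≠ x)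
    (h3 : ∀ x, σ (σ (σ x)) = x) (x : H) : Nat.card {y : H // σ.SameCycle x y} = 3 := by
  classical
  have e : {y : H | σ.SameCycle x y} = (({x, σ x, σ (σ x)} : Finset H) : Set H) := by
    ext y
    simp only [Set.mem_ofPred_eq, Finset.coe_insert, Finset.coe_singleton, Set.mem_insert_iff,
      Set.mem_singleton_iff]
    constructor
    · intro h
      refine (sameCycle_invariant σ (fun y => y = x ∨ y = σ x ∨ y = σ (σ x)) ?_ h).1 (Or.inl rfl)
      intro z
      constructor
      · rintro (h | h | h)
        · right; right; rw [← h, h3]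
        · left; exact σ.injective h
        · right; left; exact σ.injective h
      · rintro (rfl | rfl | rfl)
        · simp
        · simp
        · simp [h3]
    · rintro (rfl | rfl | rfl)
      · exact Equiv.Perm.SameCycle.refl _ _
      · exact ⟨1, by simp⟩
      · exact ⟨2, by simp [zpow_ofNat, pow_two]⟩
  change Nat.card ↥{y : H | σ.SameCycle x y} = 3
  rw [e, Nat.card_coe_set_eq, Set.ncard_coe_finset, Finset.card_eq_three]
  refine ⟨_, _, _, (hf x).symm, ?_, (hf _).symm, rfl⟩
  intro h
  apply hf x
  conv_lhs => rw [h]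
  exact h3 x

theorem card_cycle2 {H : Type} (σ : Equiv.Perm H) (hf : ∀ x, σ x ≠ x)
    (h2 : ∀ x, σ (σ x) = x) (x : H) : Nat.card {y : H // σ.SameCycle x y} = 2 := by
  classical
  have e : {y : H | σ.SameCycle x y} = (({x, σ x} : Finset H) : Set H) := by
    ext y
    simp only [Set.mem_ofPred_eq, Finset.coe_insert, Finset.coe_singleton, Set.mem_insert_iff,
      Set.mem_singleton_iff]
    constructor
    · intro h
      refine (sameCycle_invariant σ (fun y => y = x ∨ y = σ x) ?_ h).1 (Or.inl rfl)
      intro z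
      constructor
      · rintro (h | h)
        · right; rw [← h, h2]
        · left; exact σ.injective h
      · rintro (rfl | rfl)
        · simp
        · simp [h2]
    · rintro (rfl | rfl)
      · exact Equiv.Perm.SameCycle.refl _ _
      · exact ⟨1, by simp⟩
  change Nat.card ↥{y : H | σ.SameCycle x y} = 2
  rw [e, Nat.card_coe_set_eq, Set.ncard_coe_finset, Finset.card_eq_two]
  exact ⟨_, _, (hf x).symm, rfl⟩

/-- For all `g ≥ 0`, `r ≥ 1` with `2 − 2g − r < 0`, there is a connected trivalent fat
graph `(H, ι, σ)` (half-edges `H`, fixed-point-free involution `ι`, vertex permutation `σ`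
with all orbits of size `3`) of genus `g` with exactly `r` boundary components (orbits of
`σ ∘ ι`), admitting an independent set `W` of vertices (σ-orbits) consisting of exactly
half of the vertices: no half-edge `h` has both the σ-orbit of `h` and the σ-orbit of
`ι h` in `W`. -/
theorem exists_fatGraph_with_half_independent_set
    (g r : ℕ) (hr : 1 ≤ r) (hχ : (2 : ℤ) - 2 * (g : ℤ) - (r : ℤ) < 0) :
    ∃ (H : Type) (_ : Finite H) (ι σ : Equiv.Perm H),
      -- ι is a fixed-point-free involution
      (∀ h : H, ι h ≠ h) ∧ ι * ι = 1 ∧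
      -- trivalent: every σ-orbit has exactly 3 elements
      (∀ h : H, Nat.card {x : H // σ.SameCycle h x} = 3) ∧
      -- connected: the group generated by ι and σ acts transitively on H
      (∀ a b : H, ∃ τ ∈ Subgroup.closure ({ι, σ} : Set (Equiv.Perm H)), τ a = b) ∧
      -- exactly r boundary components
      Nat.card (Quotient (cycleSetoid (σ * ι))) = r ∧
      -- Euler relation: #vertices − #edges + #boundary components = 2 − 2g
      ((Nat.card (Quotient (cycleSetoid σ)) : ℤ)
          - (Nat.card (Quotient (cycleSetoid ι)) : ℤ)
          + (Nat.card (Quotient (cycleSetoid (σ * ι))) : ℤ) = 2 - 2 * (g : ℤ)) ∧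
      -- an independent set of exactly half of the vertices
      ∃ W : Set (Quotient (cycleSetoid σ)),
        2 * Nat.card W = Nat.card (Quotient (cycleSetoid σ)) ∧
        ∀ h : H, ¬(Quotient.mk (cycleSetoid σ) h ∈ W ∧
          Quotient.mk (cycleSetoid σ) (ι h) ∈ W) := by
  obtain ⟨k, E, a, b, hE, hk⟩ := exists_good g r hr hχ
  have := hE.fin
  set ι : Equiv.Perm (E ⊕ E) := Equiv.sumComm E E with hι
  set σ : Equiv.Perm (E ⊕ E) := Equiv.sumCongr a b with hσ
  have ιl : ∀ x, ι (Sum.inl x) = Sum.inr x := fun x => rfl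
  have ιr : ∀ x, ι (Sum.inr x) = Sum.inl x := fun x => rfl
  have σl : ∀ x, σ (Sum.inl x) = Sum.inl (a x) := fun x => rfl
  have σr : ∀ x, σ (Sum.inr x) = Sum.inr (b x) := fun x => rfl
  have fι : ∀ h, ι h ≠ h := by rintro (x | x) <;> simp [ιl, ιr]
  have ι2 : ∀ h, ι (ι h) = h := by rintro (x | x) <;> simp [ιl, ιr]
  have fσ : ∀ h, σ h ≠ h := by
    rintro (x | x)
    · rw [σl]; exact fun h => hE.fa x (Sum.inl_injective h)
    · rw [σr]; exact fun h => hE.fb x (Sum.inr_injective h)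
  have σ3 : ∀ h, σ (σ (σ h)) = h := by
    rintro (x | x)
    · simp [σl, hE.a3]
    · simp [σr, hE.b3]
  have tri := card_cycle3 σ fσ σ3
  have cV := card_quot σ 3 tri
  have cE := card_quot ι 2 (card_cycle2 ι fι ι2)
  have cA := card_quot a 3 (card_cycle3 a hE.fa hE.a3)
  have cH : Nat.card (E ⊕ E) = 6 * k := by rw [Nat.card_sum, hE.card]; ring
  rw [cH] at cV cE
  rw [hE.card] at cA
  have faces : Nat.card (Quotient (cycleSetoid (σ * ι))) = r := by
    let q : E → Quotient (cycleSetoid (a * b)) := Quotient.mk _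
    have hq : ∀ x, q (a (b x)) = q x := fun x =>
      Quotient.sound (s := cycleSetoid (a * b))
        (Equiv.Perm.SameCycle.symm ⟨1, by simp⟩)
    have st : ∀ x, (σ * ι).SameCycle x (σ (ι x)) := fun x => ⟨1, by simp⟩
    rw [card_of_label (σ * ι) (Sum.elim q (fun x => q (a x))), hE.faces]
    · rintro (x | x)
      · simp [ιl, σr, hq]
      · simp [ιr, σl]
    · intro t
      obtain ⟨x, rfl⟩ := Quotient.exists_rep t
      exact ⟨Sum.inl x, rfl⟩
    · have lift : ∀ x y, (a * b).SameCycle x y →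
          (σ * ι).SameCycle (Sum.inl x) (Sum.inl y) := by
        intro x y h
        refine (sameCycle_invariant (a * b)
          (fun z => (σ * ι).SameCycle (Sum.inl x) (Sum.inl z)) ?_ h).1
          (Equiv.Perm.SameCycle.refl _ _)
        intro z
        have hz : (σ * ι).SameCycle (Sum.inl z) (Sum.inl ((a * b) z)) :=
          (st (Sum.inl z)).trans (st (Sum.inr (b z)))
        exact ⟨fun h => h.trans hz.symm, fun h => h.trans hz⟩
      have key : ∀ x, ∃ y, (σ * ι).SameCycle x (Sum.inl y) ∧
          Sum.elim q (fun x => q (a x)) x = q y := by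
        rintro (x | x)
        · exact ⟨x, Equiv.Perm.SameCycle.refl _ _, rfl⟩
        · exact ⟨a x, st (Sum.inr x), rfl⟩
      intro x y hxy
      obtain ⟨x', hx, hx'⟩ := key x
      obtain ⟨y', hy, hy'⟩ := key y
      rw [hx', hy'] at hxy
      exact (hx.trans (lift _ _ (Quotient.exact (s := cycleSetoid (a * b)) hxy))).trans hy.symm
  have ll : ∀ x y, a.SameCycle x y ↔ σ.SameCycle (Sum.inl x) (Sum.inl y) := by
    intro x y
    constructor
    · intro h
      refine (sameCycle_invariant a
        (fun z => σ.SameCycle (Sum.inl x) (Sum.inl z)) ?_ h).1 (Equiv.Perm.SameCycle.refl _ _)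
      intro z
      rw [← σl, Equiv.Perm.sameCycle_apply_right]
    · intro h
      refine (sameCycle_invariant σ
        (Sum.elim (fun z => a.SameCycle x z) (fun _ => False)) ?_ h).1
        (Equiv.Perm.SameCycle.refl _ _)
      rintro (z | z)
      · simp [σl]
      · simp [σr]
  have lr : ∀ x y, ¬ σ.SameCycle (Sum.inl x) (Sum.inr y) := by
    intro x y h
    refine (sameCycle_invariant σ (Sum.elim (fun _ => True) (fun _ => False)) ?_ h).1 trivial
    rintro (z | z)
    · simp [σl]
    · simp [σr]
  let j : Quotient (cycleSetoid a) → Quotient (cycleSetoid σ) :=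
    Quotient.lift (s := cycleSetoid a) (fun x => Quotient.mk (cycleSetoid σ) (Sum.inl x))
      (fun x y h => Quotient.sound (s := cycleSetoid σ) ((ll x y).1 h))
  have jinj : Function.Injective j := by
    intro x y
    induction x using Quotient.inductionOn
    induction y using Quotient.inductionOn
    intro h
    exact Quotient.sound (s := cycleSetoid a)
      ((ll _ _).2 (Quotient.exact (s := cycleSetoid σ) h))
  have jr : ∀ x, Quotient.mk (cycleSetoid σ) (Sum.inr x) ∉ Set.range j := by
    rintro x ⟨t, ht⟩
    induction t using Quotient.inductionOn
    exact lr _ _ (Quotient.exact (s := cycleSetoid σ) ht)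
  refine ⟨E ⊕ E, inferInstance, ι, σ, fι, Equiv.ext ι2, tri, ?_, faces, ?_, Set.range j, ?_, ?_⟩
  · intro u v
    have hιm : ι ∈ Subgroup.closure ({ι, σ} : Set (Equiv.Perm (E ⊕ E))) :=
      Subgroup.subset_closure (by simp)
    have hσm : σ ∈ Subgroup.closure ({ι, σ} : Set (Equiv.Perm (E ⊕ E))) :=
      Subgroup.subset_closure (by simp)
    let p : E ⊕ E → Prop := fun v =>
      ∃ τ ∈ Subgroup.closure ({ι, σ} : Set (Equiv.Perm (E ⊕ E))), τ u = v
    have pm : ∀ ρ ∈ Subgroup.closure ({ι, σ} : Set (Equiv.Perm (E ⊕ E))), ∀ x,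
        p (ρ x) ↔ p x := by
      intro ρ hρ x
      constructor
      · rintro ⟨τ, hτ, h⟩
        exact ⟨ρ⁻¹ * τ, mul_mem (inv_mem hρ) hτ, by simp [h]⟩
      · rintro ⟨τ, hτ, h⟩
        exact ⟨ρ * τ, mul_mem hρ hτ, by simp [h]⟩
    have pι : ∀ x, p (Sum.inr x) ↔ p (Sum.inl x) := fun x => pm ι hιm (Sum.inl x)
    have cc := hE.conn (fun x => p (Sum.inl x)) (fun x => pm σ hσm (Sum.inl x))
      (fun x => by rw [← pι, ← pι]; exact pm σ hσm (Sum.inr x))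
    have pu : p u := ⟨1, one_mem _, rfl⟩
    change p v
    rcases u with u | u <;> rcases v with v | v
    · exact cc u v pu
    · exact (pι v).2 (cc u v pu)
    · exact cc u v ((pι u).1 pu)
    · exact (pι v).2 (cc u v ((pι u).1 pu))
  · rw [faces]; omega
  · rw [Nat.card_congr (Equiv.ofInjective j jinj).symm]; omega
  · rintro (x | x) ⟨h1, h2⟩
    · exact jr x h2
    · exact jr x h1
end

section
/- Let A be a finite type with at least 2 elements, let I = A × Bool with the involution (a, ε)⁻¹ := (a, ¬ε), and let X = {x : ℤ → I | for all n, x(n+1) ≠ (x(n))⁻¹} with shift map σ(x)(n) := x(n+1) and metric d(x, y) = 2^{−min{|n| : x(n) ≠ y(n)}} for x ≠ y, d(x, x) = 0. For a continuous F : X → ℝ define the pressure P(F) := limsup_{n→∞} (1/n)·log ( Σ_{x : σⁿ(x) = x} exp( F(x) + F(σ(x)) + ⋯ + F(σ^{n−1}(x)) ) ) (the set of fixed points of σⁿ is finite for each n). Then for any two Hölder continuous functions F₁, F₂ : X → ℝ, the function t ↦ P(F₁ + t·F₂) is real-analytic on ℝ. -/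
/-- The two-sided subshift of finite type with alphabet `I = A × Bool` (the symbol
`(a, ε)` has inverse `(a, ¬ε)`), forbidding a symbol to be immediately followed by
its inverse. -/
def SubshiftX (A : Type*) : Type _ :=
  {x : ℤ → A × Bool // ∀ n : ℤ, x (n + 1) ≠ ((x n).1, !(x n).2)}

/-- The shift map `σ` on the subshift: `σ(x)(n) = x(n+1)`. -/
def shiftMap {A : Type*} (x : SubshiftX A) : SubshiftX A :=
  ⟨fun n => x.1 (n + 1), fun n => x.2 (n + 1)⟩

open Classical in
/-- The metric on the subshift: `d(x, y) = 2^{−min{|n| : x n ≠ y n}}` for `x ≠ y`,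
and `d(x, x) = 0`. -/
noncomputable def subshiftDist {A : Type*} (x y : SubshiftX A) : ℝ :=
  if x = y then 0
  else (2 : ℝ) ^ (-((sInf {k : ℕ | ∃ n : ℤ, x.1 n ≠ y.1 n ∧ n.natAbs = k} : ℕ) : ℤ))

/-- A function on the subshift is Hölder continuous if
`|F x − F y| ≤ C · d(x, y)^θ` for some `C ≥ 0` and `θ ∈ (0, 1]`. -/
def IsHolder {A : Type*} (F : SubshiftX A → ℝ) : Prop :=
  ∃ C : ℝ, 0 ≤ C ∧ ∃ θ : ℝ, θ ∈ Set.Ioc (0 : ℝ) 1 ∧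
    ∀ x y : SubshiftX A, |F x - F y| ≤ C * subshiftDist x y ^ θ

/-- The Birkhoff sum `F(x) + F(σ x) + ⋯ + F(σ^{p−1} x)`. -/
noncomputable def birkhoff {A : Type*} (F : SubshiftX A → ℝ) (p : ℕ) (x : SubshiftX A) : ℝ :=
  ∑ i ∈ Finset.range p, F (shiftMap^[i] x)

/-- The alphabet `A × Bool` carries the discrete topology. -/
instance (A : Type*) : TopologicalSpace (A × Bool) := ⊥

/-- The subshift carries the Tychonoff (product) topology, which is the topology of
the metric `subshiftDist`. -/
instance (A : Type*) : TopologicalSpace (SubshiftX A) :=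
  inferInstanceAs (TopologicalSpace
    {x : ℤ → A × Bool // ∀ n : ℤ, x (n + 1) ≠ ((x n).1, !(x n).2)})

/-- The partition function `Z_n(F) = Σ_{σⁿ x = x} exp(F(x) + F(σx) + ⋯ + F(σ^{n−1}x))`
(the set of fixed points of `σⁿ` is finite, so the finite sum `∑ᶠ` is the honest sum). -/
noncomputable def partitionSum {A : Type*} (F : SubshiftX A → ℝ) (n : ℕ) : ℝ :=
  ∑ᶠ x : {x : SubshiftX A // shiftMap^[n] x = x}, Real.exp (birkhoff F n x.1)

/-- The pressure `P(F) := limsup_{n→∞} (1/n) · log Z_n(F)`. -/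
noncomputable def pressure {A : Type*} (F : SubshiftX A → ℝ) : ℝ :=
  Filter.limsup (fun n : ℕ => Real.log (partitionSum F n) / (n : ℝ)) Filter.atTop

noncomputable section
structure MarkovSys (Y I : Type*) [Fintype I] where
  p : I → Y → ℝ
  c : I → Y → Y
  agr : ℕ → Y → Y → Prop
  κ : ℕ → ℝ
  τ : ℕ → ℝ
  ρ : ℝ
  g : Y → ℝ
  M : ℝ
  p_nonneg : ∀ a y, 0 ≤ p a y
  p_sum : ∀ y, ∑ a, p a y = 1
  agr_zero : ∀ y y', agr 0 y y'
  κ_zero : κ 0 = 1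
  κ_nonneg : ∀ n, 0 ≤ κ n
  κ_le : ∀ n, κ n ≤ 1
  overlap : ∀ n y y', agr n y y' → 1 - τ n ≤ ∑ a, min (p a y) (p a y')
  agr_c : ∀ n y y' a, agr n y y' → 0 < p a y → 0 < p a y' → agr (n + 1) (c a y) (c a y')
  κ_step : ∀ n, κ (n + 1) + τ n * (1 - κ (n + 1)) ≤ ρ * κ n
  ρ_nonneg : 0 ≤ ρ
  ρ_lt : ρ < 1
  M_pos : 0 < M
  g_bd : ∀ y, |g y| ≤ M
  g_var : ∀ n y y', agr n y y' → |g y - g y'| ≤ M * κ n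

namespace MarkovSys
variable {Y I : Type*} [Fintype I] (S : MarkovSys Y I)

def Vr (f : Y → ℂ) (B : ℝ) : Prop := ∀ n y y', S.agr n y y' → ‖f y - f y'‖ ≤ B * S.κ n

def P (f : Y → ℂ) (y : Y) : ℂ := ∑ a, (S.p a y : ℂ) * f (S.c a y)

variable {S}

lemma Vr.mono {f : Y → ℂ} {B B' : ℝ} (h : S.Vr f B) (hB : B ≤ B') : S.Vr f B' :=
  fun n y y' ha => (h n y y' ha).trans (mul_le_mul_of_nonneg_right hB (S.κ_nonneg n))

lemma Vr.osc {f : Y → ℂ} {B : ℝ} (h : S.Vr f B) (y y' : Y) : ‖f y - f y'‖ ≤ B := by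
  simpa [S.κ_zero] using h 0 y y' (S.agr_zero y y')

lemma Vr.add {f g : Y → ℂ} {B B' : ℝ} (h : S.Vr f B) (h' : S.Vr g B') :
    S.Vr (fun y => f y + g y) (B + B') := fun n y y' ha => by
  have : f y + g y - (f y' + g y') = (f y - f y') + (g y - g y') := by ring
  rw [this, add_mul]
  exact (norm_add_le _ _).trans (add_le_add (h n y y' ha) (h' n y y' ha))

lemma Vr.smul {f : Y → ℂ} {B : ℝ} (h : S.Vr f B) (α : ℂ) :
    S.Vr (fun y => α * f y) (‖α‖ * B) := fun n y y' ha => by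
  rw [← mul_sub, norm_mul, mul_assoc]
  exact mul_le_mul_of_nonneg_left (h n y y' ha) (norm_nonneg _)

lemma Vr.mul {f g : Y → ℂ} {B B' s s' : ℝ} (h : S.Vr f B) (h' : S.Vr g B')
    (hs : ∀ y, ‖f y‖ ≤ s) (hs' : ∀ y, ‖g y‖ ≤ s') :
    S.Vr (fun y => f y * g y) (s * B' + B * s') := fun n y y' ha => by
  have : f y * g y - f y' * g y' = f y * (g y - g y') + (f y - f y') * g y' := by ring
  rw [this]
  refine (norm_add_le _ _).trans ?_
  rw [norm_mul, norm_mul]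
  have h1 := mul_le_mul (hs y) (h' n y y' ha) (norm_nonneg _) ((norm_nonneg _).trans (hs y))
  have h2 := mul_le_mul (h n y y' ha) (hs' y') (norm_nonneg _) ((norm_nonneg _).trans (h n y y' ha))
  linarith

lemma coupling {r r' : I → ℝ} {f f' : I → ℂ} {t B : ℝ} (hr : ∀ a, 0 ≤ r a) (hr' : ∀ a, 0 ≤ r' a)
    (h1 : ∑ a, r a = t) (h2 : ∑ a, r' a = t) (hB : ∀ a b, ‖f a - f' b‖ ≤ B) :
    ‖∑ a, (r a : ℂ) * f a - ∑ a, (r' a : ℂ) * f' a‖ ≤ t * B := by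
  have ht : 0 ≤ t := h1 ▸ Finset.sum_nonneg (fun a _ => hr a)
  rcases ht.eq_or_lt with h0 | h0
  · rw [← h0] at h1 h2
    have e1 : ∀ a, r a = 0 := fun a =>
      (Finset.sum_eq_zero_iff_of_nonneg (fun a _ => hr a)).1 h1 a (Finset.mem_univ _)
    have e2 : ∀ a, r' a = 0 := fun a =>
      (Finset.sum_eq_zero_iff_of_nonneg (fun a _ => hr' a)).1 h2 a (Finset.mem_univ _)
    simp [e1, e2, ← h0]
  · have e : (t : ℂ) * (∑ a, (r a : ℂ) * f a - ∑ a, (r' a : ℂ) * f' a)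
        = ∑ a, ∑ b, (r a : ℂ) * (r' b : ℂ) * (f a - f' b) := by
      have k1 : (t : ℂ) = ∑ a, (r a : ℂ) := by rw [← h1]; push_cast; rfl
      have k2 : (t : ℂ) = ∑ a, (r' a : ℂ) := by rw [← h2]; push_cast; rfl
      rw [mul_sub]
      nth_rewrite 1 [k2]
      rw [k1, Finset.sum_mul_sum, Finset.sum_mul_sum, Finset.sum_comm, ← Finset.sum_sub_distrib]
      refine Finset.sum_congr rfl fun a _ => ?_
      rw [← Finset.sum_sub_distrib]
      refine Finset.sum_congr rfl fun b _ => ?_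
      ring
    have e' : ‖(t : ℂ) * (∑ a, (r a : ℂ) * f a - ∑ a, (r' a : ℂ) * f' a)‖ ≤ t * t * B := by
      rw [e]
      calc _ ≤ ∑ a, ∑ b, r a * r' b * B := by
            refine (norm_sum_le _ _).trans (Finset.sum_le_sum fun a _ => ?_)
            refine (norm_sum_le _ _).trans (Finset.sum_le_sum fun b _ => ?_)
            rw [norm_mul, norm_mul, Complex.norm_real, Complex.norm_real, Real.norm_of_nonneg (hr a),
              Real.norm_of_nonneg (hr' b)]
            exact mul_le_mul_of_nonneg_left (hB a b) (mul_nonneg (hr a) (hr' b))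
        _ = t * t * B := by
            simp_rw [← Finset.sum_mul, ← Finset.mul_sum, h2, ← Finset.sum_mul, h1]
    rw [norm_mul, Complex.norm_real, Real.norm_of_nonneg ht, mul_assoc] at e'
    exact le_of_mul_le_mul_left e' h0

lemma Vr.P {f : Y → ℂ} {B : ℝ} (h : S.Vr f B) (hB : 0 ≤ B) : S.Vr (S.P f) (S.ρ * B) := by
  intro n y y' ha
  set m : I → ℝ := fun a => min (S.p a y) (S.p a y') with hm
  set t : ℝ := 1 - ∑ a, m a with ht
  have hm0 : ∀ a, 0 ≤ m a := fun a => le_min (S.p_nonneg a y) (S.p_nonneg a y')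
  have c := coupling (r := fun a => S.p a y - m a) (r' := fun a => S.p a y' - m a)
    (f := fun a => f (S.c a y)) (f' := fun a => f (S.c a y')) (t := t) (B := B)
    (fun a => sub_nonneg.2 (min_le_left _ _)) (fun a => sub_nonneg.2 (min_le_right _ _))
    (by rw [Finset.sum_sub_distrib, S.p_sum]) (by rw [Finset.sum_sub_distrib, S.p_sum])
    (fun a b => h.osc _ _)
  have d : ‖∑ a, (m a : ℂ) * (f (S.c a y) - f (S.c a y'))‖ ≤ (1 - t) * (B * S.κ (n + 1)) := by
    have : 1 - t = ∑ a, m a := by rw [ht]; ring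
    rw [this, Finset.sum_mul]
    refine (norm_sum_le _ _).trans (Finset.sum_le_sum fun a _ => ?_)
    rw [norm_mul, Complex.norm_real, Real.norm_of_nonneg (hm0 a)]
    rcases (hm0 a).eq_or_lt with h0 | h0
    · simp [← h0]
    · exact mul_le_mul_of_nonneg_left (h _ _ _ (S.agr_c n y y' a ha
        (h0.trans_le (min_le_left _ _)) (h0.trans_le (min_le_right _ _)))) (hm0 a)
  have e : S.P f y - S.P f y' = ∑ a, (m a : ℂ) * (f (S.c a y) - f (S.c a y'))
      + (∑ a, ((S.p a y - m a : ℝ) : ℂ) * f (S.c a y)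
        - ∑ a, ((S.p a y' - m a : ℝ) : ℂ) * f (S.c a y')) := by
    unfold MarkovSys.P
    rw [← Finset.sum_sub_distrib, ← Finset.sum_sub_distrib, ← Finset.sum_add_distrib]
    refine Finset.sum_congr rfl fun a _ => ?_
    push_cast; ring
  rw [e]
  refine (norm_add_le _ _).trans ((add_le_add d c).trans ?_)
  have ht' : t ≤ S.τ n := by have := S.overlap n y y' ha; rw [ht]; linarith
  have k1 := S.κ_step n
  have k2 := S.κ_le (n + 1)
  have k3 : t * (1 - S.κ (n+1)) ≤ S.τ n * (1 - S.κ (n+1)) :=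
    mul_le_mul_of_nonneg_right ht' (by linarith)
  have k4 : B * (S.κ (n+1) + t * (1 - S.κ (n+1))) ≤ B * (S.ρ * S.κ n) :=
    mul_le_mul_of_nonneg_left (by linarith) hB
  linarith

lemma P_norm {f : Y → ℂ} {s : ℝ} (h : ∀ y, ‖f y‖ ≤ s) (y : Y) : ‖S.P f y‖ ≤ s := by
  calc ‖S.P f y‖ ≤ ∑ a, S.p a y * s := by
        refine (norm_sum_le _ _).trans (Finset.sum_le_sum fun a _ => ?_)
        rw [norm_mul, Complex.norm_real, Real.norm_of_nonneg (S.p_nonneg a y)]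
        exact mul_le_mul_of_nonneg_left (h _) (S.p_nonneg a y)
    _ = s := by rw [← Finset.sum_mul, S.p_sum, one_mul]

lemma P_sub (f g : Y → ℂ) (y : Y) : S.P (fun x => f x - g x) y = S.P f y - S.P g y := by
  simp [MarkovSys.P, mul_sub]

lemma P_one (y : Y) : S.P (fun _ => 1) y = 1 := by
  have := S.p_sum y
  simp only [MarkovSys.P, mul_one]
  exact_mod_cast this

variable (S)
def w (z : ℂ) (y : Y) : ℂ := Complex.exp (z * S.g y)
variable {S}

lemma w_sub_one {z : ℂ} (hz : ‖z‖ * S.M ≤ 1) (y : Y) : ‖S.w z y - 1‖ ≤ 6 * S.M * ‖z‖ := by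
  have h1 : ‖z * S.g y‖ ≤ ‖z‖ * S.M := by
    rw [norm_mul, Complex.norm_real]
    exact mul_le_mul_of_nonneg_left (S.g_bd y) (norm_nonneg _)
  have := Complex.norm_exp_sub_one_le (h1.trans hz)
  have h2 := S.M_pos
  have h3 := mul_nonneg (norm_nonneg z) h2.le
  unfold w
  linarith

lemma w_var {z : ℂ} (hz : ‖z‖ * S.M ≤ 1) : S.Vr (fun y => S.w z y - 1) (6 * S.M * ‖z‖) := by
  intro n y y' ha
  have h1 : ∀ y, ‖z * S.g y‖ ≤ ‖z‖ * S.M := fun y => by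
    rw [norm_mul, Complex.norm_real]
    exact mul_le_mul_of_nonneg_left (S.g_bd y) (norm_nonneg _)
  have h2 : ‖z * (S.g y - S.g y' : ℝ)‖ ≤ ‖z‖ * S.M * S.κ n := by
    rw [norm_mul, Complex.norm_real, mul_assoc]
    exact mul_le_mul_of_nonneg_left (S.g_var n y y' ha) (norm_nonneg _)
  have h3 := mul_nonneg (norm_nonneg z) S.M_pos.le
  have h4 : ‖z * (S.g y - S.g y' : ℝ)‖ ≤ 1 := by
    refine h2.trans ?_
    calc _ ≤ ‖z‖ * S.M * 1 := mul_le_mul_of_nonneg_left (S.κ_le n) h3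
      _ ≤ 1 := by linarith
  have e : S.w z y - 1 - (S.w z y' - 1)
      = S.w z y' * (Complex.exp (z * (S.g y - S.g y' : ℝ)) - 1) := by
    unfold w
    rw [mul_sub, ← Complex.exp_add]
    push_cast
    ring_nf
  rw [e, norm_mul]
  have h5 : ‖S.w z y'‖ ≤ 3 := by
    have := Complex.norm_exp_sub_one_le ((h1 y').trans hz)
    have h6 := norm_le_norm_sub_add (S.w z y') 1
    rw [norm_one] at h6
    have h7 := h1 y'
    unfold w at *
    linarith
  have h6 := Complex.norm_exp_sub_one_le h4
  calc _ ≤ 3 * (2 * (‖z‖ * S.M * S.κ n)) := by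
        apply mul_le_mul h5 (by linarith) (norm_nonneg _) (by norm_num)
    _ = _ := by ring

variable (S)
def stepNum (z : ℂ) (f : Y → ℂ) : Y → ℂ := S.P (fun y => S.w z y * f y)
def step (y₀ : Y) (z : ℂ) (f : Y → ℂ) : Y → ℂ := fun y => (S.stepNum z f y₀)⁻¹ * S.stepNum z f y
def rad : ℝ := (1 - S.ρ) / 100
/-- radius of the parameter disc -/
def eps : ℝ := (1 - S.ρ) / 100 * ((1 - S.ρ) / 100) / (6 * S.M)
variable {S}

lemma rad_pos : 0 < S.rad := by have := S.ρ_lt; unfold rad; linarith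
lemma rad_le : S.rad ≤ 1 / 100 := by have := S.ρ_nonneg; unfold rad; linarith
lemma rho_eq : S.ρ = 1 - 100 * S.rad := by unfold rad; ring

lemma eps_pos : 0 < S.eps := by
  have := S.ρ_lt; have := S.M_pos; unfold eps
  have : 0 < 1 - S.ρ := by linarith
  positivity

lemma eta_le {z : ℂ} (hz : ‖z‖ ≤ S.eps) : 6 * S.M * ‖z‖ ≤ S.rad * S.rad := by
  have := S.M_pos
  unfold eps at hz
  rw [le_div_iff₀ (by positivity)] at hz
  unfold rad; linarith

lemma zM_le {z : ℂ} (hz : ‖z‖ ≤ S.eps) : ‖z‖ * S.M ≤ 1 := by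
  have h1 := eta_le hz
  have h2 := S.rad_pos
  have h3 := S.rad_le
  have h4 := mul_nonneg (norm_nonneg z) S.M_pos.le
  nlinarith

lemma wf_var {z : ℂ} (hz : ‖z‖ ≤ S.eps) {f : Y → ℂ} {b s : ℝ} (hf : S.Vr f b)
    (hs : ∀ y, ‖f y‖ ≤ s) :
    S.Vr (fun y => S.w z y * f y) (b + 6 * S.M * ‖z‖ * (b + s)) := by
  have := hf.add ((w_var (zM_le hz)).mul hf (w_sub_one (zM_le hz)) hs)
  convert this using 1
  · ext y; ring
  · ring

lemma wf_norm {z : ℂ} (hz : ‖z‖ ≤ S.eps) {f : Y → ℂ} {s : ℝ} 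
    (hs : ∀ y, ‖f y‖ ≤ s) (y : Y) : ‖S.w z y * f y‖ ≤ 2 * s := by
  rw [norm_mul]
  have h1 := w_sub_one (zM_le hz) y
  have h2 := norm_le_norm_sub_add (S.w z y) 1
  have h3 := eta_le hz
  have h4 := S.rad_le
  have h5 := S.rad_pos
  rw [norm_one] at h2
  exact mul_le_mul (by nlinarith) (hs y) (norm_nonneg _) (by norm_num)

variable {y₀ : Y}

lemma sup_of {f : Y → ℂ} {r : ℝ} (hf : S.Vr f r) (h0 : f y₀ = 1) (y : Y) : ‖f y‖ ≤ 1 + r := by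
  have h1 := hf.osc y y₀
  have h2 := norm_le_norm_sub_add (f y) (f y₀)
  rw [h0, norm_one] at h2
  rw [h0] at h1
  linarith

lemma num_var {z : ℂ} (hz : ‖z‖ ≤ S.eps) {f : Y → ℂ} (h0 : f y₀ = 1) (hf : S.Vr f S.rad) :
    S.Vr (S.stepNum z f) (S.ρ * (S.rad + 3 * S.rad * S.rad)) := by
  have h1 := (wf_var hz hf (sup_of hf h0))
  have h3 := eta_le hz
  have h4 := S.rad_le
  have h5 := S.rad_pos
  refine Vr.P (h1.mono ?_) (by positivity)
  have : 0 ≤ 6 * S.M * ‖z‖ := by have := S.M_pos; positivity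
  have := mul_le_mul h3 (show S.rad + (1 + S.rad) ≤ 3 by linarith) (by linarith) (by positivity)
  linarith

lemma num_y0 {z : ℂ} (hz : ‖z‖ ≤ S.eps) {f : Y → ℂ} (h0 : f y₀ = 1) (hf : S.Vr f S.rad) (y : Y) :
    ‖S.stepNum z f y - 1‖ ≤ 2 * S.rad := by
  have e : S.stepNum z f y - 1 = S.P (fun y => S.w z y * f y - 1) y := by
    rw [P_sub (S := S) (fun y => S.w z y * f y) (fun _ => 1), P_one]; rfl
  rw [e]
  refine P_norm (fun y => ?_) y
  have e : S.w z y * f y - 1 = (S.w z y - 1) * f y + (f y - f y₀) := by rw [h0]; ring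
  rw [e]
  refine (norm_add_le _ _).trans ?_
  rw [norm_mul]
  have h1 := hf.osc y y₀
  have h2 := w_sub_one (zM_le hz) y
  have h3 := eta_le hz
  have h4 := S.rad_le
  have h5 := S.rad_pos
  have h6 := mul_le_mul (h2.trans h3) (sup_of hf h0 y) (norm_nonneg _) (by positivity)
  nlinarith

lemma num_ne {z : ℂ} (hz : ‖z‖ ≤ S.eps) {f : Y → ℂ} (h0 : f y₀ = 1) (hf : S.Vr f S.rad) (y : Y) :
    S.stepNum z f y ≠ 0 ∧ ‖(S.stepNum z f y)⁻¹‖ ≤ 1 + 4 * S.rad := by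
  have h1 := num_y0 hz h0 hf y
  have h4 := S.rad_le
  have h5 := S.rad_pos
  have h2 : 1 - 2 * S.rad ≤ ‖S.stepNum z f y‖ := by
    have := norm_sub_norm_le 1 (S.stepNum z f y)
    rw [norm_one, norm_sub_rev] at this
    linarith
  have h3 : 0 < ‖S.stepNum z f y‖ := by linarith
  refine ⟨norm_pos_iff.1 h3, ?_⟩
  rw [norm_inv, inv_le_iff_one_le_mul₀ h3]
  nlinarith

lemma step_y0 {z : ℂ} (hz : ‖z‖ ≤ S.eps) {f : Y → ℂ} (h0 : f y₀ = 1) (hf : S.Vr f S.rad) :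
    S.step y₀ z f y₀ = 1 := inv_mul_cancel₀ (num_ne hz h0 hf y₀).1

lemma step_var {z : ℂ} (hz : ‖z‖ ≤ S.eps) {f : Y → ℂ} (h0 : f y₀ = 1) (hf : S.Vr f S.rad) :
    S.Vr (S.step y₀ z f) S.rad := by
  have h4 := S.rad_le
  have h5 := S.rad_pos
  refine ((num_var hz h0 hf).smul _).mono ?_
  have hr := S.ρ_nonneg
  refine (mul_le_mul_of_nonneg_right (num_ne hz h0 hf y₀).2 (by positivity)).trans ?_
  rw [rho_eq]
  have : (1 + 4 * S.rad) * ((1 - 100 * S.rad) * (1 + 3 * S.rad)) ≤ 1 := by nlinarith [mul_pos h5 h5, mul_pos h5 (mul_pos h5 h5)]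
  nlinarith

lemma step_contr {z : ℂ} (hz : ‖z‖ ≤ S.eps) {f f' : Y → ℂ} (h0 : f y₀ = 1) (hf : S.Vr f S.rad)
    (h0' : f' y₀ = 1) (hf' : S.Vr f' S.rad) {b : ℝ} (hb : S.Vr (fun y => f y - f' y) b) :
    S.Vr (fun y => S.step y₀ z f y - S.step y₀ z f' y) ((1 - 50 * S.rad) * b) ∧
    ‖S.stepNum z f y₀ - S.stepNum z f' y₀‖ ≤ 2 * b := by
  have h4 := S.rad_le
  have h5 := S.rad_pos
  have h3 := eta_le hz
  have hr := S.ρ_nonneg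
  have hb0 : 0 ≤ b := (norm_nonneg _).trans (hb.osc y₀ y₀)
  have hs : ∀ y, ‖f y - f' y‖ ≤ b := fun y => by
    have := hb.osc y y₀
    simpa [h0, h0'] using this
  have e1 : ∀ y, S.stepNum z f y - S.stepNum z f' y = S.P (fun y => S.w z y * (f y - f' y)) y := by
    intro y
    simp_rw [mul_sub]
    rw [P_sub (S := S) (fun y => S.w z y * f y) (fun y => S.w z y * f' y)]; rfl
  have hd : ‖S.stepNum z f y₀ - S.stepNum z f' y₀‖ ≤ 2 * b := by
    rw [e1]
    exact P_norm (wf_norm hz hs) y₀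
  refine ⟨?_, hd⟩
  have v1 : S.Vr (fun y => S.stepNum z f y - S.stepNum z f' y)
      (S.ρ * (b + S.rad * S.rad * (b + b))) := by
    have : (fun y => S.stepNum z f y - S.stepNum z f' y) = S.P (fun y => S.w z y * (f y - f' y)) :=
      funext e1
    rw [this]
    refine Vr.P ((wf_var hz hb hs).mono ?_) (by positivity)
    have := mul_le_mul_of_nonneg_right h3 (show 0 ≤ b + b by linarith)
    linarith
  obtain ⟨n1, n2⟩ := num_ne hz h0 hf y₀
  obtain ⟨n1', n2'⟩ := num_ne hz h0' hf' y₀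
  have v2 := (v1.smul (S.stepNum z f y₀)⁻¹).add ((num_var hz h0' hf').smul
    ((S.stepNum z f y₀)⁻¹ * (S.stepNum z f' y₀)⁻¹ * (S.stepNum z f' y₀ - S.stepNum z f y₀)))
  have e2 : (fun y => S.step y₀ z f y - S.step y₀ z f' y) =
      fun y => (S.stepNum z f y₀)⁻¹ * (S.stepNum z f y - S.stepNum z f' y) +
      (S.stepNum z f y₀)⁻¹ * (S.stepNum z f' y₀)⁻¹ * (S.stepNum z f' y₀ - S.stepNum z f y₀) *
      S.stepNum z f' y := by
    ext y
    unfold step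
    field_simp
    ring
  rw [e2]
  refine v2.mono ?_
  rw [norm_mul, norm_mul, norm_sub_rev (S.stepNum z f' y₀)]
  have k1 : ‖(S.stepNum z f y₀)⁻¹‖ * (S.ρ * (b + S.rad * S.rad * (b + b))) ≤
      (1 + 4 * S.rad) * (S.ρ * (b + S.rad * S.rad * (b + b))) :=
    mul_le_mul_of_nonneg_right n2 (by positivity)
  have k2 : ‖(S.stepNum z f y₀)⁻¹‖ * ‖(S.stepNum z f' y₀)⁻¹‖ *
      ‖S.stepNum z f y₀ - S.stepNum z f' y₀‖ * (S.ρ * (S.rad + 3 * S.rad * S.rad)) ≤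
      (1 + 4 * S.rad) * (1 + 4 * S.rad) * (2 * b) * (S.ρ * (S.rad + 3 * S.rad * S.rad)) := by
    gcongr
  refine (add_le_add k1 k2).trans ?_
  have k3 : (1 + 4 * S.rad) * (S.ρ * (1 + S.rad * S.rad * 2)) + 
     (1 + 4 * S.rad) * (1 + 4 * S.rad) * 2 * (S.ρ * (S.rad + 3 * S.rad * S.rad)) ≤ 1 - 50 * S.rad := by
    have a1 : (1 + 4 * S.rad) * (1 + S.rad * S.rad * 2) ≤ 1 + 5 * S.rad := by nlinarith [mul_pos h5 h5]
    have a2 : (1 + 4 * S.rad) * (1 + 4 * S.rad) ≤ 2 := by nlinarith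
    have a3 : (S.rad + 3 * S.rad * S.rad) ≤ 2 * S.rad := by nlinarith
    have a4 : (1 + 4 * S.rad) * (1 + 4 * S.rad) * (S.rad + 3 * S.rad * S.rad) ≤ 2 * (2 * S.rad) := by
      gcongr
    have a5 : (1 + 4 * S.rad) * (1 + S.rad * S.rad * 2) + 2 * ((1 + 4 * S.rad) * (1 + 4 * S.rad) * (S.rad + 3 * S.rad * S.rad)) ≤ 1 + 13 * S.rad := by linarith
    have a6 := mul_le_mul_of_nonneg_left a5 hr
    have a7 : S.ρ * (1 + 13 * S.rad) ≤ 1 - 50 * S.rad := by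
      rw [rho_eq]; nlinarith
    linarith
  have k4 := mul_le_mul_of_nonneg_right k3 hb0
  linarith

variable (S) in
def itr (y₀ : Y) (z : ℂ) : ℕ → Y → ℂ
  | 0 => fun _ => 1
  | k + 1 => S.step y₀ z (itr y₀ z k)

variable (S) in
def al (y₀ : Y) (z : ℂ) (k : ℕ) : ℂ := S.stepNum z (S.itr y₀ z k) y₀

lemma itr_inv {z : ℂ} (hz : ‖z‖ ≤ S.eps) (k : ℕ) :
    S.itr y₀ z k y₀ = 1 ∧ S.Vr (S.itr y₀ z k) S.rad := by
  induction k with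
  | zero =>
    refine ⟨rfl, fun n y y' _ => ?_⟩
    simpa [itr] using mul_nonneg S.rad_pos.le (S.κ_nonneg n)
  | succ k ih => exact ⟨step_y0 hz ih.1 ih.2, step_var hz ih.1 ih.2⟩

lemma itr_diff {z : ℂ} (hz : ‖z‖ ≤ S.eps) (k : ℕ) :
    S.Vr (fun y => S.itr y₀ z (k + 1) y - S.itr y₀ z k y) ((1 - 50 * S.rad) ^ k * (2 * S.rad)) := by
  induction k with
  | zero =>
    have h1 := (itr_inv (y₀ := y₀) hz 1).2
    have h2 := ((itr_inv (y₀ := y₀) hz 0).2.smul (-1))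
    have := h1.add h2
    convert this using 1
    · ext y; ring
    · simp; ring
  | succ k ih =>
    have := (step_contr hz (itr_inv (y₀ := y₀) hz (k+1)).1 (itr_inv (y₀ := y₀) hz (k+1)).2
      (itr_inv (y₀ := y₀) hz k).1 (itr_inv (y₀ := y₀) hz k).2 ih).1
    rw [pow_succ', mul_assoc]
    exact this

lemma al_diff {z : ℂ} (hz : ‖z‖ ≤ S.eps) (k : ℕ) :
    ‖S.al y₀ z (k + 1) - S.al y₀ z k‖ ≤ 4 * S.rad * (1 - 50 * S.rad) ^ k := by
  have := (step_contr hz (itr_inv (y₀ := y₀) hz (k+1)).1 (itr_inv (y₀ := y₀) hz (k+1)).2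
      (itr_inv (y₀ := y₀) hz k).1 (itr_inv (y₀ := y₀) hz k).2 (itr_diff hz k)).2
  unfold al
  linarith

lemma al_near {z : ℂ} (hz : ‖z‖ ≤ S.eps) (k : ℕ) : ‖S.al y₀ z k - 1‖ ≤ 1 / 2 := by
  have := num_y0 hz (itr_inv (y₀ := y₀) hz k).1 (itr_inv (y₀ := y₀) hz k).2 y₀
  have h4 := S.rad_le
  unfold al; linarith

lemma itr_diffble (k : ℕ) (y : Y) :
    DifferentiableOn ℂ (fun z => S.itr y₀ z k y) (Metric.ball 0 S.eps) := by
  induction k generalizing y with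
  | zero => exact differentiableOn_const _
  | succ k ih =>
    have h : ∀ y, DifferentiableOn ℂ (fun z => S.stepNum z (S.itr y₀ z k) y) (Metric.ball 0 S.eps) := by
      intro y
      unfold stepNum MarkovSys.P w
      refine DifferentiableOn.fun_sum fun a _ => ?_
      refine (differentiableOn_const _).mul (DifferentiableOn.mul ?_ (ih _))
      fun_prop
    have : (fun z => S.itr y₀ z (k+1) y) = fun z => (S.stepNum z (S.itr y₀ z k) y₀)⁻¹ *
      S.stepNum z (S.itr y₀ z k) y := rfl
    rw [this]
    refine DifferentiableOn.mul (DifferentiableOn.inv (h y₀) fun z hz => ?_) (h y)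
    have hz : ‖z‖ ≤ S.eps := by simpa using (Metric.mem_ball.1 hz).le
    exact (num_ne hz (itr_inv hz k).1 (itr_inv hz k).2 y₀).1

lemma al_diffble (k : ℕ) :
    DifferentiableOn ℂ (fun z => S.al y₀ z k) (Metric.ball 0 S.eps) := by
  unfold al stepNum MarkovSys.P w
  refine DifferentiableOn.fun_sum fun a _ => ?_
  refine (differentiableOn_const _).mul (DifferentiableOn.mul ?_ (itr_diffble k _))
  fun_prop

lemma itr_prod {z : ℂ} (hz : ‖z‖ ≤ S.eps) (n : ℕ) :
    (S.stepNum z)^[n] (fun _ => 1) = fun y => (∏ k ∈ Finset.range n, S.al y₀ z k) * S.itr y₀ z n y := by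
  induction n with
  | zero => ext y; simp [itr]
  | succ n ih =>
    rw [Function.iterate_succ_apply', ih]
    ext y
    have e : S.stepNum z (fun y => (∏ k ∈ Finset.range n, S.al y₀ z k) * S.itr y₀ z n y) y
       = (∏ k ∈ Finset.range n, S.al y₀ z k) * S.stepNum z (S.itr y₀ z n) y := by
      unfold stepNum MarkovSys.P
      rw [Finset.mul_sum]
      refine Finset.sum_congr rfl fun a _ => ?_
      ring
    rw [e, Finset.prod_range_succ, mul_assoc]
    congr 1
    change _ = S.al y₀ z n * ((S.stepNum z (S.itr y₀ z n) y₀)⁻¹ * S.stepNum z (S.itr y₀ z n) y)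
    have := (num_ne hz (itr_inv (y₀ := y₀) hz n).1 (itr_inv (y₀ := y₀) hz n).2 y₀).1
    unfold al
    field_simp

variable (S) in
theorem main (y₀ : Y) : ∃ Λ : ℂ → ℂ, AnalyticAt ℂ Λ 0 ∧ Λ 0 ∈ Complex.slitPlane ∧
    ∃ r > 0, ∀ z : ℂ, ‖z‖ < r → 
    Filter.Tendsto (fun n : ℕ => Real.log ‖(S.stepNum z)^[n] (fun _ => 1) y₀‖ / (n : ℝ)) Filter.atTop
      (nhds (Real.log ‖Λ z‖)) := by
  have h4 := S.rad_le
  have h5 := S.rad_pos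
  have hr := S.ρ_nonneg
  have hr2 := S.rho_eq
  have hsum : Summable (fun k : ℕ => 4 * S.rad * (1 - 50 * S.rad) ^ k) :=
    (summable_geometric_of_lt_one (by linarith) (by linarith)).mul_left _
  have hzz : ∀ z ∈ Metric.ball (0:ℂ) S.eps, ‖z‖ ≤ S.eps := fun z hz => by
    simpa using (Metric.mem_ball.1 hz).le
  have hlim : ∀ z ∈ Metric.ball (0:ℂ) S.eps, Filter.Tendsto (fun k => S.al y₀ z k) Filter.atTop
      (nhds (S.al y₀ z 0 + ∑' k, (S.al y₀ z (k+1) - S.al y₀ z k))) := by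
    intro z hz
    have h1 : Summable (fun k => (S.al y₀ z (k+1) - S.al y₀ z k)) :=
      Summable.of_norm_bounded hsum (al_diff (hzz z hz))
    have h2 := h1.hasSum.tendsto_sum_nat
    have h3 := h2.const_add (S.al y₀ z 0)
    refine h3.congr fun n => ?_
    rw [Finset.sum_range_sub]; ring
  have hnear : ∀ z ∈ Metric.ball (0:ℂ) S.eps,
      ‖(S.al y₀ z 0 + ∑' k, (S.al y₀ z (k+1) - S.al y₀ z k)) - 1‖ ≤ 1/2 := fun z hz =>
    le_of_tendsto ((hlim z hz).sub_const 1).norm (Filter.Eventually.of_forall (al_near (hzz z hz)))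
  have h0 : (0:ℂ) ∈ Metric.ball (0:ℂ) S.eps := Metric.mem_ball_self S.eps_pos
  have hne : ∀ u : ℂ, ‖u - 1‖ ≤ 1/2 → 0 < u.re := fun u hu => by
    have := Complex.abs_re_le_norm (u - 1)
    have := abs_le.1 (this.trans hu)
    simp at this
    linarith
  refine ⟨fun z => S.al y₀ z 0 + ∑' k, (S.al y₀ z (k+1) - S.al y₀ z k), ?_, ?_, S.eps, S.eps_pos, ?_⟩
  · refine DifferentiableOn.analyticAt (s := Metric.ball 0 S.eps) ?_ (Metric.isOpen_ball.mem_nhds h0)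
    refine (al_diffble 0).add ?_
    exact Complex.differentiableOn_tsum_of_summable_norm hsum
      (fun k => (al_diffble (k+1)).sub (al_diffble k)) Metric.isOpen_ball
      (fun k z hz => al_diff (hzz z hz) k)
  · exact Or.inl (hne _ (hnear 0 h0))
  · intro z hz
    have hz' : z ∈ Metric.ball (0:ℂ) S.eps := by simpa using hz
    have hn0 : ∀ u : ℂ, ‖u - 1‖ ≤ 1/2 → ‖u‖ ≠ 0 := fun u hu h => by
      have := hne u hu
      rw [norm_eq_zero] at h
      simp [h] at this
    have c1 := ((hlim z hz').norm.log (hn0 _ (hnear z hz'))).cesaro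
    refine c1.congr fun n => ?_
    rw [itr_prod (y₀ := y₀) hz.le]
    simp only
    rw [(itr_inv hz.le n).1, mul_one, norm_prod, Real.log_prod, div_eq_inv_mul]
    intro k _
    exact hn0 _ (al_near hz.le k)
end MarkovSys
end

noncomputable section
lemma kappa_exists {c θ ε : ℝ} (hc : 0 ≤ c) (hθ : 0 < θ) (hθ1 : θ < 1) (hε : 0 < ε) (hε1 : ε ≤ 1) :
    ∃ (κ : ℕ → ℝ) (ρ : ℝ), κ 0 = 1 ∧ (∀ n, κ n ≤ 1) ∧ (∀ n, θ ^ n / 2 ≤ κ n) ∧ 0 ≤ ρ ∧ ρ < 1 ∧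
      ∀ n, κ (n + 1) + min (1 - ε) (c * θ ^ n) * (1 - κ (n + 1)) ≤ ρ * κ n := by
  obtain ⟨N₀, hN₀⟩ : ∃ N : ℕ, θ ^ N < (1 - θ) / (4 * (c + 1)) :=
    exists_pow_lt_of_lt_one (div_pos (by linarith) (by linarith)) hθ1
  set N := N₀ + 1 with hN
  have hcN : c * θ ^ N ≤ (1 - θ) / 4 := by
    have h1 : θ ^ N ≤ θ ^ N₀ := pow_le_pow_of_le_one hθ.le hθ1.le (by omega)
    rw [lt_div_iff₀ (by linarith)] at hN₀
    have h2 : 0 < θ ^ N := pow_pos hθ N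
    nlinarith
  set δ := ε / 2 with hδ
  have hδ0 : 0 < δ := by linarith
  have hδ1 : δ ≤ 1 := by linarith
  have hδp : ∀ k, 0 < δ ^ k ∧ δ ^ k ≤ 1 := fun k => ⟨pow_pos hδ0 k, pow_le_one₀ hδ0.le hδ1⟩
  have hθp : ∀ k, 0 < θ ^ k ∧ θ ^ k ≤ 1 := fun k => ⟨pow_pos hθ k, pow_le_one₀ hθ.le hθ1.le⟩
  let κ : ℕ → ℝ := fun n => if n = 0 then 1 else if n < N then 1 - δ ^ (N - n) / 2 else θ ^ (n - N) / 2
  have k0 : κ 0 = 1 := by simp [κ]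
  have k1 : ∀ n, n < N → 1 - δ ^ (N - n) / 2 ≤ κ n := by
    intro n hn
    by_cases h : n = 0
    · subst h; rw [k0]; linarith [(hδp (N - 0)).1]
    · simp [κ, h, hn]
  have k2 : ∀ n, N ≤ n → κ n = θ ^ (n - N) / 2 := by
    intro n hn
    have : n ≠ 0 := by omega
    simp [κ, this, not_lt.2 hn]
  have k3 : ∀ n, n < N → κ (n + 1) = 1 - δ ^ (N - n - 1) / 2 := by
    intro n hn
    by_cases h : n + 1 < N
    · simp [κ, h]; rw [Nat.sub_sub]
    · have : N = n + 1 := by omega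
      rw [k2 _ (by omega), this]; simp; norm_num
  have k4 : ∀ n, κ n ≤ 1 := by
    intro n
    rcases n with _ | n
    · rw [k0]
    · by_cases h : n < N
      · rw [k3 n h]; linarith [(hδp (N - n - 1)).1]
      · rw [k2 _ (by omega)]; linarith [(hθp (n + 1 - N)).2]
  refine ⟨κ, max ((1 + θ) / 2) (1 - δ ^ N / 2), k0, k4, ?_, ?_, ?_, ?_⟩
  · intro n
    by_cases h : n < N
    · refine le_trans ?_ (k1 n h)
      linarith [(hθp n).2, (hδp (N - n)).2]
    · rw [k2 n (by omega)]
      have : θ ^ n ≤ θ ^ (n - N) := pow_le_pow_of_le_one hθ.le hθ1.le (by omega)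
      linarith
  · exact le_max_of_le_left (by linarith)
  · exact max_lt (by linarith) (by linarith [(hδp N).1])
  · intro n
    set τ := min (1 - ε) (c * θ ^ n) with hτ
    have t0 : 0 ≤ τ := le_min (by linarith) (mul_nonneg hc (hθp n).1.le)
    by_cases h : n < N
    · have a1 : κ n * (1 - δ ^ N / 2) ≤ κ n * max ((1 + θ) / 2) (1 - δ ^ N / 2) := by
        refine mul_le_mul_of_nonneg_left (le_max_right _ _) ?_
        refine le_trans ?_ (k1 n h)
        linarith [(hδp (N - n)).2]
      have a2 := k1 n h
      have a3 := k4 n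
      have a4 : δ ^ N ≤ δ ^ (N - n) := pow_le_pow_of_le_one hδ0.le hδ1 (by omega)
      have a5 : δ ^ (N - n) = ε / 2 * δ ^ (N - n - 1) := by
        rw [← hδ, ← pow_succ']; congr 1; omega
      rw [k3 n h]
      have a6 : τ ≤ 1 - ε := min_le_left _ _
      have a7 := (hδp (N - n - 1)).1
      have a8 := mul_le_mul_of_nonneg_right a6 a7.le
      have a9 := (hδp N).1
      have a10 : κ n * δ ^ N ≤ 1 * δ ^ N := mul_le_mul_of_nonneg_right a3 a9.le
      linarith
    · rw [k2 n (by omega), k2 (n + 1) (by omega)]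
      have e1 : n + 1 - N = (n - N) + 1 := by omega
      have e2 : θ ^ n = θ ^ N * θ ^ (n - N) := by rw [← pow_add]; congr 1; omega
      have a1 : τ ≤ (1 - θ) / 4 * θ ^ (n - N) := by
        refine (min_le_right _ _).trans ?_
        rw [e2, ← mul_assoc]
        exact mul_le_mul_of_nonneg_right hcN (hθp _).1.le
      have a2 : θ ^ (n - N) / 2 * ((1 + θ) / 2) ≤ 
         θ ^ (n - N) / 2 * max ((1 + θ) / 2) (1 - δ ^ N / 2) :=
        mul_le_mul_of_nonneg_left (le_max_left _ _) (by linarith [(hθp (n - N)).1])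
      rw [e1, pow_succ]
      have a3 : 0 ≤ τ * (θ ^ (n - N) * θ / 2) :=
        mul_nonneg t0 (by have := (hθp (n - N)).1; positivity)
      linarith

lemma quasi_lower {l : ℕ → ℝ} {D : ℝ} (h : ∀ m n, |l (m + n) - l m - l n| ≤ D) :
    ∃ L, Filter.Tendsto (fun n : ℕ => l n / n) Filter.atTop (nhds L) ∧ ∀ n : ℕ, n * L ≤ l n + D := by
  have hs : Subadditive (fun n => l n + D) := fun m n => by
    have := (abs_le.1 (h m n)).2
    linarith
  have hlow : ∀ n : ℕ, n * (l 1 - D) ≤ l n + D := by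
    intro n
    induction n with
    | zero =>
      have := (abs_le.1 (h 0 0)).2
      simp at this ⊢
      linarith
    | succ n ih =>
      have := (abs_le.1 (h n 1)).1
      push_cast
      linarith
  have hb : BddBelow (Set.range fun n : ℕ => (l n + D) / n) := by
    refine ⟨min 0 (l 1 - D), ?_⟩
    rintro _ ⟨n, rfl⟩
    rcases Nat.eq_zero_or_pos n with h0 | h0
    · subst h0; simp
    · refine (min_le_right _ _).trans ?_
      simp only
      rw [le_div_iff₀ (by exact_mod_cast h0)]
      linarith [hlow n]
  have ht := hs.tendsto_lim hb
  refine ⟨hs.lim, ?_, ?_⟩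
  · have h2 : Filter.Tendsto (fun n : ℕ => D / (n : ℝ)) Filter.atTop (nhds 0) :=
      tendsto_const_div_atTop_nhds_zero_nat D
    have := ht.sub h2
    rw [sub_zero] at this
    refine this.congr fun n => ?_
    ring
  · intro n
    rcases Nat.eq_zero_or_pos n with h0 | h0
    · subst h0
      have := hlow 0
      simpa using this
    · have := hs.lim_le_div hb (n := n) (by omega)
      rw [le_div_iff₀ (by exact_mod_cast h0)] at this
      linarith

lemma quasi_lim {l : ℕ → ℝ} {D : ℝ} (h : ∀ m n, |l (m + n) - l m - l n| ≤ D) :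
    ∃ L, ∀ n : ℕ, |l n - n * L| ≤ D := by
  obtain ⟨L, h1, h2⟩ := quasi_lower h
  obtain ⟨L', h1', h2'⟩ := quasi_lower (l := fun n => - l n) (D := D) (fun m n => by
    rw [← abs_neg]; convert h m n using 2; ring)
  have : L' = -L := by
    refine tendsto_nhds_unique h1' ?_
    refine h1.neg.congr fun n => ?_
    ring
  refine ⟨L, fun n => abs_le.2 ⟨by linarith [h2 n], ?_⟩⟩
  have := h2' n
  rw [‹L' = -L›] at this
  linarith
end

noncomputable section
/-- one-sided subshift -/
def OS (A : Type*) : Type _ :=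
  {y : ℕ → A × Bool // ∀ n : ℕ, y (n + 1) ≠ ((y n).1, !(y n).2)}

namespace OS
variable {A : Type*}

def adm (a b : A × Bool) : Prop := b ≠ (a.1, !a.2)

lemma adm_self (a : A × Bool) : adm a a := by
  intro h
  have := congrArg Prod.snd h
  simp at this

lemma adm_iff (a b : A × Bool) : adm a b ↔ a ≠ (b.1, !b.2) := by
  unfold adm
  obtain ⟨a, e⟩ := a
  obtain ⟨b, f⟩ := b
  simp only [ne_eq, Prod.mk.injEq, not_and]
  constructor
  · rintro h rfl h2; exact h rfl (by simp [h2])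
  · rintro h rfl h2; exact h rfl (by simp [h2])

def sh (y : OS A) : OS A := ⟨fun n => y.1 (n + 1), fun n => y.2 (n + 1)⟩

def agr (n : ℕ) (y y' : OS A) : Prop := ∀ i < n, y.1 i = y'.1 i

open Classical in
def cons (a : A × Bool) (y : OS A) : OS A :=
  if h : adm a (y.1 0) then
    ⟨fun n => match n with | 0 => a | n + 1 => y.1 n,
     fun n => match n with | 0 => h | n + 1 => y.2 n⟩
  else y

open Classical in
def wt (a : A × Bool) (y : OS A) : ℝ := if adm a (y.1 0) then 1 else 0

lemma wt_nonneg (a : A × Bool) (y : OS A) : 0 ≤ wt a y := by unfold wt; split_ifs <;> norm_num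
lemma wt_le (a : A × Bool) (y : OS A) : wt a y ≤ 1 := by unfold wt; split_ifs <;> norm_num
lemma wt_adm {a : A × Bool} {y : OS A} (h : adm a (y.1 0)) : wt a y = 1 := by simp [wt, h]
lemma wt_nadm {a : A × Bool} {y : OS A} (h : ¬ adm a (y.1 0)) : wt a y = 0 := by simp [wt, h]
lemma adm_of_wt {a : A × Bool} {y : OS A} (h : 0 < wt a y) : adm a (y.1 0) := by
  by_contra h'; rw [wt_nadm h'] at h; exact lt_irrefl _ h

lemma cons_zero {a : A × Bool} {y : OS A} (h : adm a (y.1 0)) : (cons a y).1 0 = a := by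
  simp [cons, h]
lemma cons_succ {a : A × Bool} {y : OS A} (h : adm a (y.1 0)) (n : ℕ) :
    (cons a y).1 (n + 1) = y.1 n := by
  simp [cons, h]
lemma sh_cons {a : A × Bool} {y : OS A} (h : adm a (y.1 0)) : sh (cons a y) = y :=
  Subtype.ext (funext fun n => cons_succ h n)
lemma agr_cons {a : A × Bool} {y y' : OS A} (h : adm a (y.1 0)) (h' : adm a (y'.1 0)) {n : ℕ}
    (H : agr n y y') : agr (n + 1) (cons a y) (cons a y') := by
  intro i hi
  rcases i with _ | i
  · rw [cons_zero h, cons_zero h']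
  · rw [cons_succ h, cons_succ h']; exact H i (by omega)

lemma agr_symm {n : ℕ} {y y' : OS A} (h : agr n y y') : agr n y' y := fun i hi => (h i hi).symm
lemma agr_mono {n m : ℕ} {y y' : OS A} (h : agr n y y') (hm : m ≤ n) : agr m y y' :=
  fun i hi => h i (by omega)

lemma exists_ne2 [Fintype A] (hA : 2 ≤ Fintype.card A) (u v : A × Bool) : ∃ c : A × Bool, c ≠ u ∧ c ≠ v := by
  have : Nontrivial A := Fintype.one_lt_card_iff_nontrivial.1 hA
  obtain ⟨x, hx⟩ := exists_ne u.1
  refine ⟨(x, !v.2), fun h => hx (congrArg Prod.fst h), fun h => ?_⟩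
  have := congrArg Prod.snd h
  simp at this

lemma exists_common [Fintype A] (hA : 2 ≤ Fintype.card A) (b b' : A × Bool) : ∃ a, adm a b ∧ adm a b' := by
  obtain ⟨c, h1, h2⟩ := exists_ne2 hA (b.1, !b.2) (b'.1, !b'.2)
  exact ⟨c, (adm_iff _ _).2 h1, (adm_iff _ _).2 h2⟩

lemma exists_link [Fintype A] (hA : 2 ≤ Fintype.card A) (a b : A × Bool) : ∃ c, adm a c ∧ adm c b := by
  obtain ⟨c, h1, h2⟩ := exists_ne2 hA (a.1, !a.2) (b.1, !b.2)
  exact ⟨c, h1, (adm_iff _ _).2 h2⟩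

variable [Fintype A]

def T (ψ : OS A → ℝ) (f : OS A → ℝ) (y : OS A) : ℝ :=
  ∑ a, wt a y * (Real.exp (ψ (cons a y)) * f (cons a y))

variable {ψ : OS A → ℝ}

lemma T_mono {f f' : OS A → ℝ} (h : ∀ y, f y ≤ f' y) (y : OS A) : T ψ f y ≤ T ψ f' y :=
  Finset.sum_le_sum fun a _ => mul_le_mul_of_nonneg_left
    (mul_le_mul_of_nonneg_left (h _) (Real.exp_pos _).le) (wt_nonneg _ _)

lemma T_smul (r : ℝ) (f : OS A → ℝ) : T ψ (fun y => r * f y) = fun y => r * T ψ f y := by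
  ext y
  unfold T
  rw [Finset.mul_sum]
  exact Finset.sum_congr rfl fun a _ => by ring

lemma T_sum {ι : Type*} (s : Finset ι) (f : ι → OS A → ℝ) (y : OS A) :
    T ψ (fun y => ∑ k ∈ s, f k y) y = ∑ k ∈ s, T ψ (f k) y := by
  unfold T
  rw [Finset.sum_comm]
  exact Finset.sum_congr rfl fun a _ => by rw [Finset.mul_sum, Finset.mul_sum]

lemma T_ge_term {f : OS A → ℝ} (hf : ∀ y, 0 ≤ f y) {a : A × Bool} {y : OS A} (h : adm a (y.1 0)) :
    Real.exp (ψ (cons a y)) * f (cons a y) ≤ T ψ f y := by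
  have := Finset.single_le_sum (f := fun a => wt a y * (Real.exp (ψ (cons a y)) * f (cons a y)))
    (fun a _ => mul_nonneg (wt_nonneg a y) (mul_nonneg (Real.exp_pos _).le (hf _))) (Finset.mem_univ a)
  simp only [wt_adm h, one_mul] at this
  exact this

lemma T_pos {f : OS A → ℝ} (hf : ∀ y, 0 < f y) (y : OS A) : 0 < T ψ f y :=
  lt_of_lt_of_le (mul_pos (Real.exp_pos _) (hf _))
    (T_ge_term (fun y => (hf y).le) (adm_self (y.1 0)))

lemma iter_mono {f f' : OS A → ℝ} (h : ∀ y, f y ≤ f' y) (n : ℕ) (y : OS A) :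
    (T ψ)^[n] f y ≤ (T ψ)^[n] f' y := by
  induction n generalizing y with
  | zero => exact h y
  | succ n ih =>
    rw [Function.iterate_succ_apply', Function.iterate_succ_apply']
    exact T_mono ih y

lemma iter_smul (r : ℝ) (f : OS A → ℝ) (n : ℕ) :
    (T ψ)^[n] (fun y => r * f y) = fun y => r * (T ψ)^[n] f y := by
  induction n with
  | zero => rfl
  | succ n ih =>
    rw [Function.iterate_succ_apply', Function.iterate_succ_apply', ih, T_smul]

lemma iter_pos {f : OS A → ℝ} (hf : ∀ y, 0 < f y) (n : ℕ) (y : OS A) : 0 < (T ψ)^[n] f y := by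
  induction n generalizing y with
  | zero => exact hf y
  | succ n ih =>
    rw [Function.iterate_succ_apply']
    exact T_pos ih y

def Hol (c θ : ℝ) (ψ : OS A → ℝ) : Prop := ∀ n y y', agr n y y' → |ψ y - ψ y'| ≤ c * θ ^ n

def Cone (b θ : ℝ) (f : OS A → ℝ) : Prop :=
  ∀ n y y', 1 ≤ n → agr n y y' → f y ≤ Real.exp (b * θ ^ n) * f y'

variable {c θ b M : ℝ}

lemma cone_T (hψ : Hol c θ ψ) (hθ : 0 < θ) (hb : (c + b) * θ ≤ b) {f : OS A → ℝ} (hf : ∀ y, 0 ≤ f y)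
    (hC : Cone b θ f) : Cone b θ (T ψ f) := by
  intro n y y' hn ha
  have h0 : y.1 0 = y'.1 0 := ha 0 (by omega)
  unfold T
  rw [Finset.mul_sum]
  refine Finset.sum_le_sum fun a _ => ?_
  by_cases h : adm a (y.1 0)
  · have h' : adm a (y'.1 0) := h0 ▸ h
    rw [wt_adm h, wt_adm h', one_mul, one_mul]
    have hac := agr_cons h h' ha
    have h1 := (abs_le.1 (hψ _ _ _ hac)).2
    have h2 := hC _ _ _ (by omega) hac
    have h3 : Real.exp (ψ (cons a y)) ≤ Real.exp (c * θ ^ (n + 1)) * Real.exp (ψ (cons a y')) := by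
      rw [← Real.exp_add]; exact Real.exp_le_exp.2 (by linarith)
    have h4 : Real.exp (c * θ ^ (n + 1)) * Real.exp (b * θ ^ (n + 1)) ≤ Real.exp (b * θ ^ n) := by
      rw [← Real.exp_add]; refine Real.exp_le_exp.2 ?_
      have := mul_le_mul_of_nonneg_right hb (pow_pos hθ n).le
      rw [pow_succ]; linarith
    calc _ ≤ (Real.exp (c * θ ^ (n + 1)) * Real.exp (ψ (cons a y'))) *
            (Real.exp (b * θ ^ (n + 1)) * f (cons a y')) :=
          mul_le_mul h3 h2 (hf _) (by positivity)
      _ = (Real.exp (c * θ ^ (n + 1)) * Real.exp (b * θ ^ (n + 1))) *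
            (Real.exp (ψ (cons a y')) * f (cons a y')) := by ring
      _ ≤ _ := mul_le_mul_of_nonneg_right h4 (mul_nonneg (Real.exp_pos _).le (hf _))
  · have h' : ¬ adm a (y'.1 0) := h0 ▸ h
    rw [wt_nadm h, wt_nadm h']; simp

lemma iter_cone (hψ : Hol c θ ψ) (hθ : 0 < θ) (hb : (c + b) * θ ≤ b) (hb0 : 0 ≤ b) (n : ℕ) :
    Cone b θ ((T ψ)^[n] (fun _ => 1)) := by
  induction n with
  | zero =>
    intro n y y' _ _
    simp
    positivity
  | succ n ih =>
    rw [Function.iterate_succ_apply']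
    exact cone_T hψ hθ hb (fun y => (iter_pos (fun _ => one_pos) n y).le) ih

lemma T_le_sup {f : OS A → ℝ} {s : ℝ} (hM : ∀ y, |ψ y| ≤ M) (hf0 : ∀ y, 0 ≤ f y) (hf : ∀ y, f y ≤ s) (y : OS A) :
    T ψ f y ≤ Fintype.card (A × Bool) * Real.exp M * s := by
  have : T ψ f y ≤ ∑ _a : A × Bool, Real.exp M * s := by
    refine Finset.sum_le_sum fun a _ => ?_
    have h1 : Real.exp (ψ (cons a y)) ≤ Real.exp M := Real.exp_le_exp.2 (abs_le.1 (hM _)).2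
    have h2 := mul_le_mul h1 (hf (cons a y)) (hf0 _) (Real.exp_pos _).le
    calc _ ≤ 1 * (Real.exp (ψ (cons a y)) * f (cons a y)) :=
          mul_le_mul_of_nonneg_right (wt_le _ _) (mul_nonneg (Real.exp_pos _).le (hf0 _))
      _ ≤ _ := by rw [one_mul]; exact h2
  refine this.trans (le_of_eq ?_)
  rw [Finset.sum_const, nsmul_eq_mul, Finset.card_univ]; ring

lemma ratio (hA : 2 ≤ Fintype.card A) (hψ : Hol c θ ψ) (hθ : 0 < θ) (hθ1 : θ < 1) (hc : 0 ≤ c)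
    (hM : ∀ y, |ψ y| ≤ M) :
    ∃ R : ℝ, 1 ≤ R ∧ ∀ n y y', (T ψ)^[n] (fun _ => 1) y ≤ R * (T ψ)^[n] (fun _ => 1) y' := by
  set b := c * θ / (1 - θ) with hb
  have h1θ : 0 < 1 - θ := by linarith
  have hb0 : 0 ≤ b := by positivity
  have hbb : (c + b) * θ ≤ b := by
    have : b * (1 - θ) = c * θ := by rw [hb]; field_simp
    linarith
  set K1 := Real.exp (b * θ ^ 1) * (Real.exp M * Real.exp M)
  have hexp : ∀ y, 1 ≤ Real.exp M * Real.exp (ψ y) := fun y => by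
    rw [← Real.exp_add]; exact Real.one_le_exp (by linarith [(abs_le.1 (hM y)).1])
  have L1 : ∀ f : OS A → ℝ, (∀ y, 0 < f y) → Cone b θ f → ∀ z y', f z ≤ K1 * T ψ (T ψ f) y' := by
    intro f hf hC z y'
    obtain ⟨d, hd1, hd2⟩ := exists_link hA (z.1 0) (y'.1 0)
    have e0 : (cons d y').1 0 = d := cons_zero hd2
    have hd3 : adm (z.1 0) ((cons d y').1 0) := by rw [e0]; exact hd1
    have i1 := T_ge_term (ψ := ψ) (fun y => (T_pos (ψ := ψ) hf y).le) hd2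
    have i2 := T_ge_term (ψ := ψ) (fun y => (hf y).le) hd3
    have i3 := hC 1 z (cons (z.1 0) (cons d y')) le_rfl (by
      intro i hi
      have : i = 0 := by omega
      subst this
      rw [cons_zero hd3])
    have j1 : T ψ f (cons d y') ≤ Real.exp M * T ψ (T ψ f) y' := by
      have a1 := hexp (cons d y')
      have a2 := T_pos (ψ := ψ) hf (cons d y')
      calc _ ≤ (Real.exp M * Real.exp (ψ (cons d y'))) * T ψ f (cons d y') :=
              le_mul_of_one_le_left a2.le a1
        _ ≤ _ := by rw [mul_assoc]; exact mul_le_mul_of_nonneg_left i1 (Real.exp_pos _).le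
    have j2 : f (cons (z.1 0) (cons d y')) ≤ Real.exp M * T ψ f (cons d y') := by
      have a1 := hexp (cons (z.1 0) (cons d y'))
      have a2 := hf (cons (z.1 0) (cons d y'))
      calc _ ≤ (Real.exp M * Real.exp (ψ _)) * f (cons (z.1 0) (cons d y')) :=
              le_mul_of_one_le_left a2.le a1
        _ ≤ _ := by rw [mul_assoc]; exact mul_le_mul_of_nonneg_left i2 (Real.exp_pos _).le
    calc f z ≤ Real.exp (b * θ ^ 1) * (Real.exp M * (Real.exp M * T ψ (T ψ f) y')) :=
          i3.trans (mul_le_mul_of_nonneg_left (j2.trans (mul_le_mul_of_nonneg_left j1 (Real.exp_pos _).le)) (Real.exp_pos _).le)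
      _ = _ := by simp only [K1]; ring
  set K2 := Fintype.card (A × Bool) * Real.exp M * (Fintype.card (A × Bool) * Real.exp M * 1)
  have L2 : ∀ y, T ψ (T ψ (fun _ => 1)) y ≤ K2 * 1 := fun y => by
    rw [mul_one]
    exact T_le_sup hM (fun y => (T_pos (fun _ => one_pos) y).le)
      (T_le_sup hM (fun _ => zero_le_one) (fun _ => le_rfl)) y
  have hK1 : 0 < K1 := by positivity
  clear_value K1 K2
  have key : ∀ n y y', (T ψ)^[n] (fun _ => 1) y ≤ (K1 * K2) * (T ψ)^[n] (fun _ => 1) y' := by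
    intro n y y'
    refine (L1 _ (iter_pos (fun _ => one_pos) n) (iter_cone hψ hθ hbb hb0 n) y y').trans ?_
    have e : T ψ (T ψ ((T ψ)^[n] (fun _ => 1))) = (T ψ)^[n] (T ψ (T ψ (fun _ => 1))) := by
      rw [← Function.iterate_succ_apply' (T ψ), ← Function.iterate_succ_apply' (T ψ)]
      rw [Function.iterate_succ_apply, Function.iterate_succ_apply]
    rw [e, mul_assoc]
    refine mul_le_mul_of_nonneg_left ?_ hK1.le
    have := iter_mono (ψ := ψ) L2 n y'
    rw [iter_smul] at this
    exact this
  refine ⟨max 1 (K1 * K2), le_max_left _ _, fun n y y' => (key n y y').trans ?_⟩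
  exact mul_le_mul_of_nonneg_right (le_max_right _ _) (iter_pos (fun _ => one_pos) n y').le

/-- existence of a positive eigenfunction -/
lemma eigen (hA : 2 ≤ Fintype.card A) (hψ : Hol c θ ψ) (hθ : 0 < θ) (hθ1 : θ < 1) (hc : 0 ≤ c)
    (hM : ∀ y, |ψ y| ≤ M) (y₀ : OS A) :
    ∃ (L : ℝ) (h : OS A → ℝ) (b s : ℝ), 0 ≤ b ∧ 0 < s ∧ (∀ y, s⁻¹ ≤ h y ∧ h y ≤ s) ∧ Cone b θ h ∧
      ∀ y, T ψ h y = Real.exp L * h y := by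
  obtain ⟨R, hR1, hR⟩ := ratio hA hψ hθ hθ1 hc hM
  have hR0 : 0 < R := by linarith
  set b := c * θ / (1 - θ) with hb
  have h1θ : 0 < 1 - θ := by linarith
  have hb0 : 0 ≤ b := by positivity
  have hbb : (c + b) * θ ≤ b := by
    have : b * (1 - θ) = c * θ := by rw [hb]; field_simp
    linarith
  set U : ℕ → OS A → ℝ := fun n => (T ψ)^[n] (fun _ => 1) with hU
  have hUpos : ∀ n y, 0 < U n y := fun n y => iter_pos (fun _ => one_pos) n y
  have hadd : ∀ m n, U (m + n) = (T ψ)^[m] (U n) := fun m n => Function.iterate_add_apply _ _ _ _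
  have up : ∀ m n, U (m + n) y₀ ≤ R * (U m y₀ * U n y₀) := by
    intro m n
    have := iter_mono (ψ := ψ) (f := U n) (f' := fun _ => (R * U n y₀) * 1)
      (fun y => by rw [mul_one]; exact hR n y y₀) m y₀
    rw [iter_smul] at this
    rw [hadd]
    refine this.trans (le_of_eq ?_)
    simp only [hU]; ring
  have lo : ∀ m n, U m y₀ * U n y₀ ≤ R * U (m + n) y₀ := by
    intro m n
    have := iter_mono (ψ := ψ) (f' := fun y => R * U n y) (f := fun _ => (U n y₀) * 1)
      (fun y => by rw [mul_one]; exact hR n y₀ y) m y₀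
    rw [iter_smul, iter_smul] at this
    rw [hadd]
    refine le_trans (le_of_eq ?_) this
    simp only [hU]; ring
  obtain ⟨L, hL⟩ := quasi_lim (l := fun n => Real.log (U n y₀)) (D := Real.log R) (by
    intro m n
    have a1 := Real.log_le_log (hUpos (m + n) y₀) (up m n)
    have a2 := Real.log_le_log (mul_pos (hUpos m y₀) (hUpos n y₀)) (lo m n)
    rw [Real.log_mul hR0.ne' (mul_pos (hUpos m y₀) (hUpos n y₀)).ne',
      Real.log_mul (hUpos m y₀).ne' (hUpos n y₀).ne'] at a1
    rw [Real.log_mul (hUpos m y₀).ne' (hUpos n y₀).ne', Real.log_mul hR0.ne' (hUpos _ y₀).ne'] at a2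
    rw [abs_le]
    constructor <;> linarith)
  have hb1 : ∀ n : ℕ, U n y₀ ≤ R * Real.exp (n * L) := by
    intro n
    have := (abs_le.1 (hL n)).2
    rw [← Real.exp_log hR0, ← Real.exp_add, ← Real.exp_log (hUpos n y₀)]
    exact Real.exp_le_exp.2 (by linarith)
  have hb2 : ∀ n : ℕ, Real.exp (n * L) ≤ R * U n y₀ := by
    intro n
    have := (abs_le.1 (hL n)).1
    rw [← Real.exp_log hR0, ← Real.exp_log (hUpos n y₀), ← Real.exp_add]
    exact Real.exp_le_exp.2 (by linarith)
  set f : ℕ → OS A → ℝ := fun n y => Real.exp (-(n * L)) * U n y with hf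
  set s := R * R with hs
  have hs0 : 0 < s := by positivity
  have fb1 : ∀ n y, f n y ≤ s := by
    intro n y
    have a1 := hR n y y₀
    have a2 := mul_le_mul_of_nonneg_left (hb1 n) hR0.le
    have a3 : U n y ≤ s * Real.exp (n * L) := by
      rw [hs, mul_assoc]; exact a1.trans a2
    have := mul_le_mul_of_nonneg_left a3 (Real.exp_pos (-(n * L))).le
    rw [mul_comm s, ← mul_assoc, ← Real.exp_add] at this
    simpa using this
  have fb2 : ∀ n y, s⁻¹ ≤ f n y := by
    intro n y
    rw [inv_le_iff_one_le_mul₀ hs0]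
    have a1 := hR n y₀ y
    have a2 := mul_le_mul_of_nonneg_left a1 hR0.le
    have a3 : Real.exp (n * L) ≤ s * U n y := by
      rw [hs, mul_assoc]; exact (hb2 n).trans a2
    have := mul_le_mul_of_nonneg_left a3 (Real.exp_pos (-(n * L))).le
    rw [← Real.exp_add] at this
    simp at this
    simp only [hf]; linarith
  have fT : ∀ n y, T ψ (f n) y = Real.exp L * f (n + 1) y := by
    intro n y
    simp only [hf]
    rw [T_smul]
    simp only [hU]
    rw [Function.iterate_succ_apply', ← mul_assoc, ← Real.exp_add]
    push_cast
    ring_nf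
  have fC : ∀ n, Cone b θ (f n) := by
    intro n k y y' hk ha
    have := iter_cone hψ hθ hbb hb0 n k y y' hk ha
    have := mul_le_mul_of_nonneg_left this (Real.exp_pos (-(n * L))).le
    simp only [hf, hU]; linarith
  -- averages
  set av : ℕ → OS A → ℝ := fun n y => ((n : ℝ) + 1)⁻¹ * ∑ k ∈ Finset.range (n + 1), f k y with hav
  have hn1 : ∀ n : ℕ, (0:ℝ) < (n : ℝ) + 1 := fun n => by positivity
  have av1 : ∀ n y, av n y ≤ s := by
    intro n y
    simp only [hav]
    rw [inv_mul_le_iff₀ (hn1 n)]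
    refine (Finset.sum_le_sum fun k _ => fb1 k y).trans (le_of_eq ?_)
    rw [Finset.sum_const, nsmul_eq_mul, Finset.card_range]; push_cast; ring
  have av2 : ∀ n y, s⁻¹ ≤ av n y := by
    intro n y
    simp only [hav]
    rw [le_inv_mul_iff₀ (hn1 n)]
    refine le_trans (le_of_eq ?_) (Finset.sum_le_sum fun k _ => fb2 k y)
    rw [Finset.sum_const, nsmul_eq_mul, Finset.card_range]; push_cast; ring
  have avC : ∀ n, Cone b θ (av n) := by
    intro n k y y' hk ha
    simp only [hav]
    rw [mul_left_comm]
    refine mul_le_mul_of_nonneg_left ?_ (inv_pos.2 (hn1 n)).le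
    rw [Finset.mul_sum]
    exact Finset.sum_le_sum fun j _ => fC j k y y' hk ha
  have avT : ∀ n y, T ψ (av n) y = Real.exp L * (av n y + ((n : ℝ) + 1)⁻¹ * (f (n + 1) y - f 0 y)) := by
    intro n y
    simp only [hav]
    rw [T_smul]
    beta_reduce
    rw [T_sum]
    simp_rw [fT]
    rw [← Finset.mul_sum, ← Finset.sum_range_sub (fun k => f k y), Finset.sum_sub_distrib]
    ring
  let 𝒰 : Ultrafilter ℕ := Filter.hyperfilter ℕ
  have h𝒰 : (𝒰 : Filter ℕ) ≤ Filter.atTop := by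
    exact Nat.hyperfilter_le_atTop
  have hex : ∀ y, ∃ l, Filter.Tendsto (fun n => av n y) 𝒰 (nhds l) := by
    intro y
    obtain ⟨l, _, hl⟩ := (isCompact_Icc (a := s⁻¹) (b := s)).ultrafilter_le_nhds (𝒰.map (fun n => av n y)) (by
      rw [Filter.le_principal_iff]
      exact Filter.mem_map.2 (Filter.Eventually.of_forall fun n => ⟨av2 n y, av1 n y⟩))
    exact ⟨l, hl⟩
  choose h hh using hex
  refine ⟨L, h, b, s, hb0, hs0, fun y => ⟨?_, ?_⟩, ?_, ?_⟩
  · exact ge_of_tendsto (hh y) (Filter.Eventually.of_forall fun n => av2 n y)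
  · exact le_of_tendsto (hh y) (Filter.Eventually.of_forall fun n => av1 n y)
  · intro k y y' hk ha
    exact le_of_tendsto_of_tendsto (hh y) ((hh y').const_mul _)
      (Filter.Eventually.of_forall fun n => avC n k y y' hk ha)
  · intro y
    have t1 : Filter.Tendsto (fun n => T ψ (av n) y) 𝒰 (nhds (T ψ h y)) := by
      unfold T
      exact tendsto_finsetSum _ fun a _ => ((hh _).const_mul _).const_mul _
    have t2 : Filter.Tendsto (fun n : ℕ => ((n : ℝ) + 1)⁻¹ * (f (n + 1) y - f 0 y)) 𝒰 (nhds 0) := by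
      refine Filter.Tendsto.mono_left ?_ h𝒰
      have z : Filter.Tendsto (fun n : ℕ => (s + s) * (1 / ((n : ℝ) + 1))) Filter.atTop (nhds 0) := by
        simpa using (tendsto_one_div_add_atTop_nhds_zero_nat (𝕜 := ℝ)).const_mul (s + s)
      refine squeeze_zero_norm (fun n => ?_) z
      rw [norm_mul, norm_inv, Real.norm_of_nonneg (hn1 n).le, mul_comm, one_div]
      refine mul_le_mul_of_nonneg_right ?_ (inv_pos.2 (hn1 n)).le
      rw [Real.norm_eq_abs, abs_le]
      have := fb1 (n+1) y
      have := fb2 (n+1) y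
      have := fb1 0 y
      have := fb2 0 y
      have := inv_pos.2 hs0
      constructor <;> linarith
    have t3 := ((hh y).add t2).const_mul (Real.exp L)
    rw [add_zero] at t3
    refine tendsto_nhds_unique t1 (t3.congr fun n => (avT n y).symm)

end OS
end

noncomputable section
namespace OS
variable {A : Type*} [Fintype A] {ψ g : OS A → ℝ} {c θ b M : ℝ}

lemma Hol.add {c' : ℝ} (h : Hol c θ ψ) (h' : Hol c' θ g) : Hol (c + c') θ (fun y => ψ y + g y) := by
  intro n y y' ha
  have h1 := abs_le.1 (h n y y' ha)
  have h2 := abs_le.1 (h' n y y' ha)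
  rw [add_mul, abs_le]
  constructor <;> linarith [h1.1, h1.2, h2.1, h2.2]

lemma Hol.smul (t : ℝ) (h : Hol c θ ψ) : Hol (|t| * c) θ (fun y => t * ψ y) := by
  intro n y y' ha
  rw [← mul_sub, abs_mul, mul_assoc]
  exact mul_le_mul_of_nonneg_left (h n y y' ha) (abs_nonneg _)

lemma Hol.sh (h : Hol c θ ψ) (hc : 0 ≤ c) (hθ : 0 < θ) (hθ1 : θ < 1) : Hol (c / θ) θ (fun y => ψ (sh y)) := by
  intro n y y' ha
  rcases n with _ | n
  · have := h 0 (OS.sh y) (OS.sh y') (fun i hi => by omega)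
    refine this.trans ?_
    refine mul_le_mul_of_nonneg_right ?_ (by positivity)
    rw [le_div_iff₀ hθ]; nlinarith
  · have := h n (OS.sh y) (OS.sh y') (fun i hi => ha (i+1) (by omega))
    refine this.trans (le_of_eq ?_)
    rw [pow_succ]; field_simp

/-- Markov system from a normalized potential -/
lemma markov_of (hA : 2 ≤ Fintype.card A) (hψ : Hol c θ ψ) (hθ : 0 < θ) (hθ1 : θ < 1) (hc : 1 ≤ c)
    (hM : ∀ y, |ψ y| ≤ M) (hM0 : 0 ≤ M) (h1 : ∀ y, T ψ (fun _ => 1) y = 1) {c' M' : ℝ}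
    (hg : Hol c' θ g) (hM' : ∀ y, |g y| ≤ M') (hM'0 : 0 ≤ M') (hc' : 0 ≤ c') :
    ∃ S : MarkovSys (OS A) (A × Bool), (∀ a y, S.p a y = wt a y * Real.exp (ψ (cons a y))) ∧
      (∀ a y, S.c a y = cons a y) ∧ (∀ y, S.g y = g y) := by
  set ε := Real.exp (-M) with hε
  obtain ⟨κ, ρ, k0, k1, k2, r0, r1, hst⟩ := kappa_exists (c := c) (by linarith) hθ hθ1 (Real.exp_pos (-M))
    (Real.exp_le_one_iff.2 (by linarith))
  have kpos : ∀ n, 0 ≤ κ n := fun n => le_trans (by positivity) (k2 n)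
  refine ⟨{ 
    p := fun a y => wt a y * Real.exp (ψ (cons a y))
    c := cons
    agr := agr
    κ := κ
    τ := fun n => min (1 - ε) (c * θ ^ n)
    ρ := ρ
    g := g
    M := M' + 2 * c' + 1
    p_nonneg := fun a y => mul_nonneg (wt_nonneg a y) (Real.exp_pos _).le
    p_sum := fun y => by
      have := h1 y
      unfold T at this
      simpa using this
    agr_zero := fun y y' i hi => by omega
    κ_zero := k0
    κ_nonneg := kpos
    κ_le := k1
    overlap := ?_
    agr_c := ?_
    κ_step := hst
    ρ_nonneg := r0
    ρ_lt := r1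
    M_pos := by linarith
    g_bd := fun y => (hM' y).trans (by linarith)
    g_var := ?_ }, fun _ _ => rfl, fun _ _ => rfl, fun _ => rfl⟩
  · intro n y y' ha
    have hlow : ∀ a y, adm a (y.1 0) → ε ≤ wt a y * Real.exp (ψ (cons a y)) := fun a y h => by
      rw [wt_adm h, one_mul]
      exact Real.exp_le_exp.2 (abs_le.1 (hM _)).1
    have hnn : ∀ a, 0 ≤ min (wt a y * Real.exp (ψ (cons a y))) (wt a y' * Real.exp (ψ (cons a y'))) :=
      fun a => le_min (mul_nonneg (wt_nonneg a y) (Real.exp_pos _).le)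
        (mul_nonneg (wt_nonneg a y') (Real.exp_pos _).le)
    have i1 : ε ≤ ∑ a, min (wt a y * Real.exp (ψ (cons a y))) (wt a y' * Real.exp (ψ (cons a y'))) := by
      obtain ⟨a, h, h'⟩ := exists_common hA (y.1 0) (y'.1 0)
      exact (le_min (hlow a y h) (hlow a y' h')).trans
        (Finset.single_le_sum (fun a _ => hnn a) (Finset.mem_univ a))
    have i2 : 1 - c * θ ^ n ≤
        ∑ a, min (wt a y * Real.exp (ψ (cons a y))) (wt a y' * Real.exp (ψ (cons a y'))) := by
      rcases n with _ | n
      · refine le_trans ?_ (Finset.sum_nonneg fun a _ => hnn a)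
        simp; exact hc
      · have h0 : y.1 0 = y'.1 0 := ha 0 (by omega)
        calc 1 - c * θ ^ (n+1) ≤ Real.exp (-(c * θ ^ (n + 1))) := by
              have := Real.add_one_le_exp (-(c * θ ^ (n + 1))); linarith
          _ = Real.exp (-(c * θ ^ (n + 1))) * T ψ (fun _ => 1) y' := by rw [h1, mul_one]
          _ ≤ _ := by
              unfold T
              rw [Finset.mul_sum]
              refine Finset.sum_le_sum fun a _ => ?_
              by_cases h : adm a (y.1 0)
              · have h' : adm a (y'.1 0) := h0 ▸ h
                rw [wt_adm h, wt_adm h', one_mul, one_mul, one_mul, mul_one, ← Real.exp_add]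
                have hac := hψ _ _ _ (agr_cons h h' ha)
                have hp : c * θ ^ (n + 1 + 1) ≤ c * θ ^ (n + 1) := 
                  mul_le_mul_of_nonneg_left (pow_le_pow_of_le_one hθ.le hθ1.le (by omega)) (by linarith)
                have hp0 : 0 ≤ c * θ ^ (n + 1) := by positivity
                have := abs_le.1 hac
                exact le_min (Real.exp_le_exp.2 (by linarith [this.1, this.2]))
                  (Real.exp_le_exp.2 (by linarith))
              · have h' : ¬ adm a (y'.1 0) := h0 ▸ h
                rw [wt_nadm h, wt_nadm h']; simp
    rcases min_choice (1 - ε) (c * θ ^ n) with h | h <;> rw [h] <;> linarith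
  · intro n y y' a ha hp hp'
    have q : ∀ y, 0 < wt a y * Real.exp (ψ (cons a y)) → adm a (y.1 0) := fun y h =>
      adm_of_wt (pos_of_mul_pos_left h (Real.exp_pos _).le)
    exact agr_cons (q y hp) (q y' hp') ha
  · intro n y y' ha
    refine (hg n y y' ha).trans ?_
    have := k2 n
    have h3 := mul_le_mul_of_nonneg_left this hc'
    have h4 := mul_nonneg hM'0 (kpos n)
    nlinarith [kpos n]

lemma stepNum_real (S : MarkovSys (OS A) (A × Bool)) (hp : ∀ a y, S.p a y = wt a y * Real.exp (ψ (cons a y)))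
    (hcc : ∀ a y, S.c a y = cons a y) (hg : ∀ y, S.g y = g y) (t : ℝ) (n : ℕ) :
    (S.stepNum (t : ℂ))^[n] (fun _ => 1) =
      fun y => (((T (fun y => ψ y + t * g y))^[n] (fun _ => 1) y : ℝ) : ℂ) := by
  induction n with
  | zero => simp
  | succ n ih =>
    rw [Function.iterate_succ_apply', Function.iterate_succ_apply', ih]
    ext y
    simp only [MarkovSys.stepNum, MarkovSys.P, MarkovSys.w, T, hp, hcc, hg]
    push_cast
    refine Finset.sum_congr rfl fun a _ => ?_
    rw [Complex.exp_add]
    ring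

theorem os_analytic (hA : 2 ≤ Fintype.card A) (hψ : Hol c θ ψ) (hθ : 0 < θ) (hθ1 : θ < 1) (hc : 0 ≤ c)
    (hM : ∀ y, |ψ y| ≤ M) (hM0 : 0 ≤ M) {c' M' : ℝ}
    (hg : Hol c' θ g) (hM' : ∀ y, |g y| ≤ M') (hM'0 : 0 ≤ M') (hc' : 0 ≤ c') (y₀ : OS A) :
    ∃ (L : ℝ) (v ψ₀ : OS A → ℝ) (V C₀ : ℝ), (∀ y, ψ₀ y = ψ y + v y - v (sh y) - L) ∧
      (∀ y, |v y| ≤ V) ∧ 0 ≤ C₀ ∧ Hol C₀ θ ψ₀ ∧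
      ∃ Λ : ℂ → ℂ, AnalyticAt ℂ Λ 0 ∧ Λ 0 ∈ Complex.slitPlane ∧ ∃ r > 0, ∀ t : ℝ, |t| < r → 
        Filter.Tendsto (fun n : ℕ => Real.log ((T (fun y => ψ₀ y + t * g y))^[n] (fun _ => 1) y₀) / (n : ℝ))
          Filter.atTop (nhds (Real.log ‖Λ t‖)) := by
  obtain ⟨L, h, b, s, hb0, hs0, hs, hC, hT⟩ := eigen hA hψ hθ hθ1 hc hM y₀
  have hpos : ∀ y, 0 < h y := fun y => (inv_pos.2 hs0).trans_le (hs y).1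
  set v : OS A → ℝ := fun y => Real.log (h y) with hv
  set V := Real.log s with hV
  have hvV : ∀ y, |v y| ≤ V := fun y => by
    have h1 := Real.log_le_log (inv_pos.2 hs0) (hs y).1
    have h2 := Real.log_le_log (hpos y) (hs y).2
    rw [Real.log_inv] at h1
    exact abs_le.2 ⟨h1, h2⟩
  have hV0 : 0 ≤ V := (abs_nonneg _).trans (hvV y₀)
  set cv := b + 2 * V
  have hcv : 0 ≤ cv := by positivity
  have hvH : Hol cv θ v := by
    intro n y y' ha
    rcases n with _ | n
    · have h1 := abs_le.1 (hvV y)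
      have h2 := abs_le.1 (hvV y')
      rw [pow_zero, mul_one, abs_le]
      constructor <;> linarith [h1.1, h1.2, h2.1, h2.2]
    · have q : ∀ y y' : OS A, agr (n+1) y y' → v y - v y' ≤ b * θ ^ (n+1) := by
        intro y y' ha
        have := Real.log_le_log (hpos y) (hC (n+1) y y' (by omega) ha)
        rw [Real.log_mul (Real.exp_pos _).ne' (hpos y').ne', Real.log_exp] at this
        linarith
      have h1 := q y y' ha
      have h2 := q y' y (agr_symm ha)
      have : b * θ ^ (n+1) ≤ cv * θ ^ (n+1) :=
        mul_le_mul_of_nonneg_right (by linarith) (by positivity)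
      rw [abs_le]; constructor <;> linarith
  set ψ₀ : OS A → ℝ := fun y => ψ y + v y - v (sh y) - L with hψ₀
  have hH : Hol (c + cv + cv / θ + 1) θ ψ₀ := by
    intro n y y' ha
    have h1 := abs_le.1 (hψ n y y' ha)
    have h2 := abs_le.1 (hvH n y y' ha)
    have h3 := abs_le.1 (hvH.sh hcv hθ hθ1 n y y' ha)
    have h4 : 0 < θ ^ n := by positivity
    rw [abs_le]
    simp only [hψ₀]
    constructor <;> linarith [h1.1, h1.2, h2.1, h2.2, h3.1, h3.2]
  have hB : ∀ y, |ψ₀ y| ≤ M + 2 * V + |L| := by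
    intro y
    have h1 := abs_le.1 (hM y)
    have h2 := abs_le.1 (hvV y)
    have h3 := abs_le.1 (hvV (sh y))
    have h4 := le_abs_self L
    have h5 := neg_abs_le L
    rw [abs_le]
    simp only [hψ₀]
    constructor <;> linarith [h1.1, h1.2, h2.1, h2.2, h3.1, h3.2]
  have h1 : ∀ y, T ψ₀ (fun _ => 1) y = 1 := by
    intro y
    have e : T ψ₀ (fun _ => 1) y = Real.exp (-L) * (h y)⁻¹ * T ψ h y := by
      unfold T
      rw [Finset.mul_sum]
      refine Finset.sum_congr rfl fun a _ => ?_
      by_cases ha : adm a (y.1 0)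
      · simp only [hψ₀, hv]
        rw [sh_cons ha, sub_eq_add_neg, sub_eq_add_neg, Real.exp_add, Real.exp_add, Real.exp_add,
          Real.exp_neg (Real.log (h y)), Real.exp_log (hpos _), Real.exp_log (hpos _)]
        ring
      · rw [wt_nadm ha]; simp
    rw [e, hT, Real.exp_neg]
    have := hpos y
    have := Real.exp_pos L
    field_simp
  obtain ⟨S, hp, hcc, hSg⟩ := markov_of hA hH hθ hθ1 (by
    have : 0 ≤ cv / θ := by positivity
    linarith) hB (by positivity) h1 hg hM' hM'0 hc'
  obtain ⟨Λ, hΛ1, hΛ2, r, hr, hΛ3⟩ := S.main y₀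
  refine ⟨L, v, ψ₀, V, _, fun y => rfl, hvV, ?_, hH, Λ, hΛ1, hΛ2, r, hr, fun t ht => ?_⟩
  · positivity
  · have := hΛ3 t (by simpa using ht)
    rw [show (fun n : ℕ => Real.log ‖(S.stepNum (t:ℂ))^[n] (fun _ => 1) y₀‖ / (n : ℝ)) = 
      (fun n : ℕ => Real.log ((T (fun y => ψ₀ y + t * g y))^[n] (fun _ => 1) y₀) / (n : ℝ)) from ?_] at this
    · exact this
    · ext n
      rw [stepNum_real S hp hcc hSg, Complex.norm_real,
        Real.norm_of_nonneg (iter_pos (fun _ => one_pos) n y₀).le]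

end OS
end

noncomputable section
namespace OS
variable {A : Type*}

/-- two-sided exponential variation bound -/
def TH (C β : ℝ) (F : SubshiftX A → ℝ) : Prop :=
  ∀ (N : ℕ) (x x' : SubshiftX A), (∀ i : ℤ, i.natAbs < N → x.1 i = x'.1 i) → |F x - F x'| ≤ C * β ^ N

lemma TH.mono {C β β' : ℝ} {F : SubshiftX A → ℝ} (h : TH C β F) (hC : 0 ≤ C) (hβ : 0 ≤ β) (hb : β ≤ β') :
    TH C β' F := fun N x x' H => (h N x x' H).trans (by gcongr)

lemma holder_TH {F : SubshiftX A → ℝ} (h : IsHolder F) : ∃ C β : ℝ, 0 ≤ C ∧ 0 < β ∧ β < 1 ∧ TH C β F := by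
  obtain ⟨C, hC, θ, ⟨hθ, _⟩, H⟩ := h
  refine ⟨C, (1/2 : ℝ) ^ θ, hC, by positivity, Real.rpow_lt_one (by norm_num) (by norm_num) hθ, ?_⟩
  intro N x x' hx
  refine (H x x').trans (mul_le_mul_of_nonneg_left ?_ hC)
  have e : ((1/2 : ℝ) ^ θ) ^ N = ((1/2 : ℝ) ^ N) ^ θ := by
    rw [← Real.rpow_natCast, ← Real.rpow_natCast, ← Real.rpow_mul (by norm_num), ← Real.rpow_mul (by norm_num), mul_comm]
  rw [e]
  unfold subshiftDist
  split_ifs with hxx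
  · exact Real.rpow_le_rpow le_rfl (by positivity) hθ.le
  · refine Real.rpow_le_rpow (by positivity) ?_ hθ.le
    rw [zpow_neg, zpow_natCast, ← inv_pow, ← one_div]
    refine pow_le_pow_of_le_one (by norm_num) (by norm_num) ?_
    have hne : ∃ n : ℤ, x.1 n ≠ x'.1 n := by
      by_contra hc
      push Not at hc
      exact hxx (Subtype.ext (funext hc))
    obtain ⟨n, hn⟩ := hne
    refine le_csInf ⟨_, n, hn, rfl⟩ ?_
    rintro k ⟨i, hi, rfl⟩
    by_contra hc
    exact hi (hx i (by omega))

def proj (x : SubshiftX A) : OS A := ⟨fun n => x.1 n, fun n => by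
  have := x.2 n
  push_cast
  exact this⟩

def lft (y : OS A) : SubshiftX A := ⟨fun i => y.1 i.toNat, fun n => by
  show y.1 (n+1).toNat ≠ ((y.1 n.toNat).1, !(y.1 n.toNat).2)
  rcases lt_or_ge n 0 with h | h
  · rw [show (n+1).toNat = 0 by omega, show n.toNat = 0 by omega]
    exact adm_self _
  · rw [show (n+1).toNat = n.toNat + 1 by omega]
    exact y.2 _⟩

lemma sh_iter (n : ℕ) (y : OS A) (i : ℕ) : (sh^[n] y).1 i = y.1 (i + n) := by
  induction n generalizing y with
  | zero => rfl
  | succ n ih => rw [Function.iterate_succ_apply, ih]; exact congrArg y.1 (by omega)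

lemma shift_iter (n : ℕ) (x : SubshiftX A) (i : ℤ) : (shiftMap^[n] x).1 i = x.1 (i + n) := by
  induction n generalizing x with
  | zero => simp
  | succ n ih => rw [Function.iterate_succ_apply, ih]; exact congrArg x.1 (by push_cast; omega)

lemma sh_proj (x : SubshiftX A) : sh (proj x) = proj (shiftMap x) := by
  refine Subtype.ext (funext fun n => ?_)
  simp [sh, proj, shiftMap]

lemma sh_proj_iter (n : ℕ) (x : SubshiftX A) : sh^[n] (proj x) = proj (shiftMap^[n] x) := by
  induction n generalizing x with
  | zero => rfl
  | succ n ih => rw [Function.iterate_succ_apply, Function.iterate_succ_apply, sh_proj, ih]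

def tm (F : SubshiftX A → ℝ) (n : ℕ) (y : OS A) : ℝ :=
  F (shiftMap^[n+1] (lft y)) - F (shiftMap^[n] (lft (sh y)))

def um (F : SubshiftX A → ℝ) (n : ℕ) (x : SubshiftX A) : ℝ :=
  F (shiftMap^[n] x) - F (shiftMap^[n] (lft (proj x)))

variable {F : SubshiftX A → ℝ} {C β γ : ℝ}

lemma tm_le (h : TH C β F) (n : ℕ) (y : OS A) : |tm F n y| ≤ C * β ^ (n+1) := by
  refine h _ _ _ fun i hi => ?_
  rw [shift_iter, shift_iter]
  simp only [lft, sh]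
  exact congrArg y.1 (by omega)

lemma um_le (h : TH C β F) (n : ℕ) (x : SubshiftX A) : |um F n x| ≤ C * β ^ (n+1) := by
  refine h _ _ _ fun i hi => ?_
  rw [shift_iter, shift_iter]
  simp only [lft, proj]
  exact congrArg x.1 (by omega)

lemma geo_summ (hβ : 0 ≤ β) (hβ1 : β < 1) (C : ℝ) : Summable (fun n : ℕ => C * β ^ (n+1)) := by
  refine Summable.mul_left _ ?_
  simp_rw [pow_succ]
  exact (summable_geometric_of_lt_one hβ hβ1).mul_right _

lemma tm_summ (h : TH C β F) (hβ : 0 ≤ β) (hβ1 : β < 1) (y : OS A) : Summable (fun n => tm F n y) :=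
  Summable.of_norm_bounded (geo_summ hβ hβ1 C) (fun n => by simpa using tm_le h n y)

lemma um_summ (h : TH C β F) (hβ : 0 ≤ β) (hβ1 : β < 1) (x : SubshiftX A) : Summable (fun n => um F n x) :=
  Summable.of_norm_bounded (geo_summ hβ hβ1 C) (fun n => by simpa using um_le h n x)

lemma tm_hol (h : TH C (γ^3) F) (hC : 0 ≤ C) (hγ : 0 ≤ γ) (hγ1 : γ < 1) (n m : ℕ) (y y' : OS A) (ha : agr m y y') :
    |tm F n y - tm F n y'| ≤ 2 * C * γ ^ m * γ ^ n := by
  rcases le_or_gt (n + m) (3 * (n+1)) with hh | hh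
  · have h1 := abs_le.1 (tm_le h n y)
    have h2 := abs_le.1 (tm_le h n y')
    have h3 : (γ^3)^(n+1) ≤ γ ^ (n+m) := by
      rw [← pow_mul]; exact pow_le_pow_of_le_one hγ hγ1.le hh
    have h4 := mul_le_mul_of_nonneg_left h3 hC
    rw [pow_add γ n m] at h4
    rw [abs_le]; constructor <;> linarith [h1.1, h1.2, h2.1, h2.2]
  · have h1 : |F (shiftMap^[n+1] (lft y)) - F (shiftMap^[n+1] (lft y'))| ≤ C * (γ^3) ^ (m - n - 1) := by
      refine h _ _ _ fun i hi => ?_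
      rw [shift_iter, shift_iter]
      simp only [lft]
      exact ha _ (by omega)
    have h2 : |F (shiftMap^[n] (lft (sh y))) - F (shiftMap^[n] (lft (sh y')))| ≤ C * (γ^3) ^ (m - n - 1) := by
      refine h _ _ _ fun i hi => ?_
      rw [shift_iter, shift_iter]
      simp only [lft, sh]
      exact ha _ (by omega)
    have h3 : (γ^3)^(m - n - 1) ≤ γ ^ (n+m) := by
      rw [← pow_mul]; exact pow_le_pow_of_le_one hγ hγ1.le (by omega)
    have h4 := mul_le_mul_of_nonneg_left h3 hC
    rw [pow_add γ n m] at h4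
    have h1 := abs_le.1 h1
    have h2 := abs_le.1 h2
    unfold tm
    rw [abs_le]; constructor <;> linarith [h1.1, h1.2, h2.1, h2.2]

lemma sinai (h : TH C (γ^3) F) (hC : 0 ≤ C) (hγ : 0 < γ) (hγ1 : γ < 1) :
    ∃ (G : OS A → ℝ) (c U : ℝ), 0 ≤ c ∧ 0 ≤ U ∧ Hol c γ G ∧
      ∀ n x, |birkhoff F n x - ∑ i ∈ Finset.range n, G (sh^[i] (proj x))| ≤ U := by
  have hβ : 0 ≤ γ^3 := by positivity
  have hβ1 : γ^3 < 1 := pow_lt_one₀ hγ.le hγ1 (by norm_num)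
  have h1γ : 0 < 1 - γ := by linarith
  set G : OS A → ℝ := fun y => F (lft y) + ∑' n, tm F n y with hG
  set u : SubshiftX A → ℝ := fun x => ∑' n, um F n x with hu
  set U : ℝ := ∑' n : ℕ, C * (γ^3) ^ (n+1) with hU
  have huU : ∀ x, |u x| ≤ U := fun x => by
    have := tsum_of_norm_bounded (f := fun n => um F n x) (geo_summ hβ hβ1 C).hasSum (fun n => by simpa using um_le h n x)
    simpa using this
  have hU0 : 0 ≤ U := tsum_nonneg fun n => by positivity
  have hid : ∀ x, G (proj x) = F x - u x + u (shiftMap x) := by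
    intro x
    have e1 : u x = um F 0 x + ∑' n, um F (n+1) x := (um_summ h hβ hβ1 x).tsum_eq_zero_add
    have s1 : Summable (fun n => um F (n+1) x) := (summable_nat_add_iff 1).2 (um_summ h hβ hβ1 x)
    have e2 := (um_summ h hβ hβ1 (shiftMap x)).tsum_sub s1
    have e3 : ∀ n, um F n (shiftMap x) - um F (n+1) x = tm F n (proj x) := by
      intro n
      unfold um tm
      rw [sh_proj, Function.iterate_succ_apply (f := shiftMap) n x]
      ring
    simp only [e3] at e2
    have e4 : um F 0 x = F x - F (lft (proj x)) := rfl
    simp only [hG]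
    have e5 : u (shiftMap x) = ∑' n, um F n (shiftMap x) := rfl
    rw [e1, e2, e4, e5]; ring
  refine ⟨G, C + 2 * C / (1 - γ), 2 * U, by positivity, by positivity, ?_, ?_⟩
  · intro m y y' ha
    have h1 : |F (lft y) - F (lft y')| ≤ C * γ ^ m := by
      refine (h m _ _ fun i hi => ?_).trans ?_
      · simp only [lft]; exact ha _ (by omega)
      · gcongr
        calc γ^3 ≤ γ^1 := pow_le_pow_of_le_one hγ.le hγ1.le (by norm_num)
          _ = γ := pow_one γ
    have h2 : |∑' n, tm F n y - ∑' n, tm F n y'| ≤ 2 * C * γ ^ m * (1 - γ)⁻¹ := by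
      rw [← (tm_summ h hβ hβ1 y).tsum_sub (tm_summ h hβ hβ1 y')]
      exact tsum_of_norm_bounded (f := fun n => tm F n y - tm F n y') (a := 2 * C * γ ^ m * (1 - γ)⁻¹) ((hasSum_geometric_of_lt_one hγ.le hγ1).mul_left _)
        (fun n => by simpa using tm_hol h hC hγ.le hγ1 n m y y' ha)
    have h1 := abs_le.1 h1
    have h2 := abs_le.1 h2
    have e : (C + 2 * C / (1 - γ)) * γ ^ m = C * γ ^ m + 2 * C * γ ^ m * (1 - γ)⁻¹ := by
      rw [div_eq_mul_inv]; ring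
    rw [e]
    simp only [hG]
    rw [abs_le]; constructor <;> linarith [h1.1, h1.2, h2.1, h2.2]
  · intro n x
    have e : birkhoff F n x - ∑ i ∈ Finset.range n, G (sh^[i] (proj x)) = u x - u (shiftMap^[n] x) := by
      unfold birkhoff
      rw [← Finset.sum_sub_distrib]
      refine Eq.trans ?_ (Finset.sum_range_sub' (fun i => u (shiftMap^[i] x)) n)
      refine Finset.sum_congr rfl fun i _ => ?_
      rw [sh_proj_iter, hid, Function.iterate_succ_apply']
      ring
    rw [e]
    have h1 := abs_le.1 (huU x)
    have h2 := abs_le.1 (huU (shiftMap^[n] x))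
    rw [abs_le]; constructor <;> linarith [h1.1, h1.2, h2.1, h2.2]

lemma Hol.bdd {c θ : ℝ} {ψ : OS A → ℝ} (h : Hol c θ ψ) (y₀ : OS A) (hc : 0 ≤ c) :
    ∃ M, 0 ≤ M ∧ ∀ y, |ψ y| ≤ M := by
  refine ⟨|ψ y₀| + c, by positivity, fun y => ?_⟩
  have := h 0 y y₀ (fun i hi => absurd hi (by omega))
  simp only [pow_zero, mul_one] at this
  calc |ψ y| = |ψ y₀ + (ψ y - ψ y₀)| := by ring_nf
    _ ≤ _ := (abs_add_le _ _).trans (by gcongr)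

end OS
end

noncomputable section
namespace OS
variable {A : Type*}

def cst (a : A × Bool) : OS A := ⟨fun _ => a, fun _ => adm_self a⟩

/-- one-sided Birkhoff sum -/
def bs (ψ : OS A → ℝ) (n : ℕ) (y : OS A) : ℝ := ∑ i ∈ Finset.range n, ψ (sh^[i] y)

variable {ψ : OS A → ℝ} {c θ M : ℝ}

lemma bs_agr (hψ : Hol c θ ψ) (hθ1 : θ < 1) (n : ℕ) (z z' : OS A) (h : agr n z z') :
    |bs ψ n z - bs ψ n z'| ≤ c / (1 - θ) * (θ - θ ^ (n+1)) := by
  induction n generalizing z z' with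
  | zero => simp [bs]
  | succ n ih =>
    have e : ∀ z, bs ψ (n+1) z = bs ψ n (sh z) + ψ z := by
      intro z
      unfold bs
      rw [Finset.sum_range_succ']
      simp only [Function.iterate_succ_apply, Function.iterate_zero_apply]
    rw [e, e]
    have h1 := abs_le.1 (ih (sh z) (sh z') (fun i hi => h (i+1) (by omega)))
    have h2 := abs_le.1 (hψ (n+1) z z' h)
    have hne : 1 - θ ≠ 0 := by linarith
    have e2 : c / (1 - θ) * (θ - θ ^ (n+1+1)) = c / (1 - θ) * (θ - θ ^ (n+1)) + c * θ ^ (n+1) := by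
      field_simp; ring
    rw [e2, abs_le]
    constructor <;> linarith [h1.1, h1.2, h2.1, h2.2]

lemma bs_agr' (hψ : Hol c θ ψ) (hc : 0 ≤ c) (hθ : 0 < θ) (hθ1 : θ < 1) (n : ℕ) (z z' : OS A) (h : agr n z z') :
    |bs ψ n z - bs ψ n z'| ≤ c / (1 - θ) := by
  refine (bs_agr hψ hθ1 n z z' h).trans ?_
  have h1 : 0 ≤ c / (1 - θ) := div_nonneg hc (by linarith)
  have h2 : 0 < θ ^ (n+1) := by positivity
  nlinarith

lemma per_add {n : ℕ} {x : SubshiftX A} (h : shiftMap^[n] x = x) (i : ℤ) : x.1 (i + n) = x.1 i := by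
  rw [← shift_iter, h]

lemma per_emod {n : ℕ} {x : SubshiftX A} (h : shiftMap^[n] x = x) (i : ℤ) : x.1 i = x.1 (i % n) := by
  have hp : Function.Periodic x.1 (n : ℤ) := fun i => per_add h i
  have := hp.int_mul (i / n) (i % n)
  rw [← this]
  rw [Int.cast_id, mul_comm, Int.emod_add_mul_ediv]

lemma per_ext {n : ℕ} (hn : 0 < n) {x x' : SubshiftX A} (h : shiftMap^[n] x = x) (h' : shiftMap^[n] x' = x')
    (H : ∀ k : ℕ, k < n → x.1 k = x'.1 k) : x = x' := by
  refine Subtype.ext (funext fun i => ?_)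
  rw [per_emod h, per_emod h']
  have h1 : 0 ≤ i % n := Int.emod_nonneg _ (by omega)
  have h2 : i % n < n := Int.emod_lt_of_pos _ (by omega)
  have := H (i % n).toNat (by omega)
  rwa [Int.toNat_of_nonneg h1] at this

lemma per_finite [Finite A] {n : ℕ} (hn : 0 < n) : Finite {x : SubshiftX A // shiftMap^[n] x = x} := by
  refine Finite.of_injective (β := Fin n → A × Bool) (fun x k => x.1.1 (k : ℕ)) ?_
  intro x x' h
  exact Subtype.ext (per_ext hn x.2 x'.2 fun k hk => congrFun h ⟨k, hk⟩)

def unwrap (n : ℕ) (x : {x : SubshiftX A // shiftMap^[n] x = x}) : OS A :=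
  ⟨fun i => if i ≤ n then x.1.1 i else x.1.1 0, fun i => by
    show adm (if i ≤ n then x.1.1 i else x.1.1 0) (if i + 1 ≤ n then x.1.1 (i + 1 : ℕ) else x.1.1 0)
    rcases lt_trichotomy i n with h | h | h
    · rw [if_pos (by omega), if_pos (by omega)]
      push_cast
      exact x.1.2 i
    · subst h
      rw [if_pos le_rfl, if_neg (by omega)]
      have := per_add x.2 0
      rw [zero_add] at this
      rw [this]
      exact adm_self _
    · rw [if_neg (by omega), if_neg (by omega)]
      exact adm_self _⟩

lemma unwrap_sh (n : ℕ) (x : {x : SubshiftX A // shiftMap^[n] x = x}) :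
    sh^[n] (unwrap n x) = cst (x.1.1 0) := by
  refine Subtype.ext (funext fun i => ?_)
  rw [sh_iter]
  simp only [unwrap, cst]
  split_ifs with h
  · have : i = 0 := by omega
    subst this
    have := per_add x.2 0
    rw [zero_add] at this
    simpa using this
  · rfl

lemma unwrap_agr (n : ℕ) (x : {x : SubshiftX A // shiftMap^[n] x = x}) : agr n (unwrap n x) (proj x.1) := by
  intro i hi
  simp only [unwrap, proj]
  rw [if_pos hi.le]

lemma unwrap_inj {n : ℕ} (hn : 0 < n) : Function.Injective (unwrap (A := A) n) := by
  intro x x' h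
  refine Subtype.ext (per_ext hn x.2 x'.2 fun k hk => ?_)
  have h1 := unwrap_agr n x k hk
  have h2 := unwrap_agr n x' k hk
  rw [h] at h1
  exact h1.symm.trans h2

lemma emod_step (n : ℕ) (i : ℤ) : (i + 1) % (n + 1 : ℤ) = if i % (n + 1 : ℤ) = n then 0 else i % (n + 1 : ℤ) + 1 := by
  have h0 := Int.emod_add_mul_ediv i (n+1)
  have h1 : 0 ≤ i % (n + 1 : ℤ) := Int.emod_nonneg _ (by omega)
  have h2 : i % (n + 1 : ℤ) < n + 1 := Int.emod_lt_of_pos _ (by omega)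
  generalize hr : i % (n + 1 : ℤ) = r at *
  generalize i / (n + 1 : ℤ) = q at *
  rw [← h0]
  split_ifs with h
  · rw [h, show (n : ℤ) + (n + 1) * q + 1 = (n + 1) * (q + 1) by ring]
    exact Int.mul_emod_right _ _
  · rw [show r + (n + 1) * q + 1 = (r + 1) + (n + 1) * q by ring, Int.add_mul_emod_self_left]
    exact Int.emod_eq_of_lt (by omega) (by omega)

def mkPer (n : ℕ) (w : ℕ → A × Bool) (h : ∀ k < n, adm (w k) (w (k+1))) (h0 : adm (w n) (w 0)) : SubshiftX A :=
  ⟨fun i => w (i % (n + 1 : ℤ)).toNat, fun i => by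
    show adm (w (i % (n + 1 : ℤ)).toNat) (w ((i+1) % (n + 1 : ℤ)).toNat)
    have h1 : 0 ≤ i % (n + 1 : ℤ) := Int.emod_nonneg _ (by omega)
    have h2 : i % (n + 1 : ℤ) < n + 1 := Int.emod_lt_of_pos _ (by omega)
    rw [emod_step]
    split_ifs with hh
    · rw [hh]; simpa using h0
    · rw [show (i % (n + 1 : ℤ) + 1).toNat = (i % (n + 1 : ℤ)).toNat + 1 by omega]
      exact h _ (by omega)⟩

lemma mkPer_per (n : ℕ) (w : ℕ → A × Bool) (h : ∀ k < n, adm (w k) (w (k+1))) (h0 : adm (w n) (w 0)) :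
    shiftMap^[n+1] (mkPer n w h h0) = mkPer n w h h0 := by
  refine Subtype.ext (funext fun i => ?_)
  rw [shift_iter]
  simp only [mkPer]
  push_cast
  rw [Int.add_emod_right]

lemma mkPer_val (n : ℕ) (w : ℕ → A × Bool) (h : ∀ k < n, adm (w k) (w (k+1))) (h0 : adm (w n) (w 0))
    (k : ℕ) (hk : k ≤ n) : (mkPer n w h h0).1 k = w k := by
  simp only [mkPer]
  rw [Int.emod_eq_of_lt (by omega) (by omega)]
  simp

lemma wrap_exists [Fintype A] (hA : 2 ≤ Fintype.card A) (n : ℕ) (hn : 0 < n) (z : OS A) :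
    ∃ x : {x : SubshiftX A // shiftMap^[n+1] x = x}, agr n (proj x.1) z := by
  obtain ⟨b, hb1, hb2⟩ := exists_link hA (z.1 (n-1)) (z.1 0)
  have h : ∀ k < n, adm ((fun k => if k < n then z.1 k else b) k) ((fun k => if k < n then z.1 k else b) (k+1)) := by
    intro k hk
    simp only [if_pos hk]
    split_ifs with h
    · exact z.2 k
    · rwa [show k = n - 1 by omega]
  have h0 : adm ((fun k => if k < n then z.1 k else b) n) ((fun k => if k < n then z.1 k else b) 0) := by
    simpa [hn] using hb2
  refine ⟨⟨mkPer n _ h h0, mkPer_per n _ h h0⟩, fun i hi => ?_⟩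
  simp only [proj]
  rw [mkPer_val n _ h h0 i hi.le, if_pos hi]

variable [Fintype A]

open Classical in
lemma pre_exists (n : ℕ) (y : OS A) : ∃ P : Finset (OS A), (∀ z, z ∈ P ↔ sh^[n] z = y) ∧
    (T ψ)^[n] (fun _ => 1) y = ∑ z ∈ P, Real.exp (bs ψ n z) := by
  induction n generalizing y with
  | zero => exact ⟨{y}, by simp, by simp [bs]⟩
  | succ n ih =>
    choose P hP1 hP2 using ih
    have hcons : ∀ w : OS A, sh w = y → adm (w.1 0) (y.1 0) ∧ cons (w.1 0) y = w := by
      intro w hw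
      have h1 : adm (w.1 0) (y.1 0) := by rw [← hw]; exact w.2 0
      refine ⟨h1, Subtype.ext (funext fun i => ?_)⟩
      rcases i with _ | i
      · exact cons_zero h1
      · rw [cons_succ h1, ← hw]; rfl
    refine ⟨(Finset.univ.filter (fun a => adm a (y.1 0))).biUnion (fun a => P (cons a y)), ?_, ?_⟩
    · intro z
      simp only [Finset.mem_biUnion, Finset.mem_filter, Finset.mem_univ, true_and, hP1]
      rw [Function.iterate_succ_apply']
      constructor
      · rintro ⟨a, ha, h⟩
        rw [h, sh_cons ha]
      · intro h
        exact ⟨_, (hcons _ h).1, (hcons _ h).2.symm⟩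
    · rw [Function.iterate_succ_apply', Finset.sum_biUnion]
      · rw [Finset.sum_filter]
        unfold T
        refine Finset.sum_congr rfl fun a _ => ?_
        split_ifs with ha
        · rw [wt_adm ha, one_mul]
          have := hP2 (cons a y)
          unfold T at this
          rw [this, Finset.mul_sum]
          refine Finset.sum_congr rfl fun z hz => ?_
          rw [← Real.exp_add]
          congr 1
          unfold bs
          rw [Finset.sum_range_succ, (hP1 _ _).1 hz, add_comm]
        · rw [wt_nadm ha, zero_mul]
      · intro a ha b hb hab
        simp only [Finset.coe_filter, Finset.mem_univ, true_and, Set.mem_setOf_eq] at ha hb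
        refine Finset.disjoint_left.2 fun z hz hz' => hab ?_
        have h1 := (hP1 _ _).1 hz
        have h2 := (hP1 _ _).1 hz'
        rw [h1] at h2
        rw [← cons_zero ha, ← cons_zero hb, h2]

end OS
end

noncomputable section
namespace OS
open Filter Topology
variable {A : Type*} [Fintype A] {ψ : OS A → ℝ} {c θ M : ℝ}

open Classical in
lemma part_upper (hψ : Hol c θ ψ) (hc : 0 ≤ c) (hθ : 0 < θ) (hθ1 : θ < 1)
    {F : SubshiftX A → ℝ} {l K : ℝ} (hF : ∀ n x, |birkhoff F n x - bs ψ n (proj x) - n * l| ≤ K)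
    {R : ℝ} (hR : ∀ n y y', (T ψ)^[n] (fun _ => 1) y ≤ R * (T ψ)^[n] (fun _ => 1) y') (y₀ : OS A)
    (n : ℕ) (hn : 0 < n) :
    partitionSum F n ≤ Real.exp (K + c / (1 - θ)) * (Fintype.card (A × Bool) * R) * 
      (Real.exp (n * l) * (T ψ)^[n] (fun _ => 1) y₀) := by
  have := per_finite (A := A) hn
  have := Fintype.ofFinite {x : SubshiftX A // shiftMap^[n] x = x}
  unfold partitionSum
  rw [finsum_eq_sum_of_fintype]
  choose P hP1 hP2 using pre_exists (A := A) (ψ := ψ) n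
  set E := Real.exp (K + c / (1 - θ) + n * l) with hE
  calc ∑ x : {x : SubshiftX A // shiftMap^[n] x = x}, Real.exp (birkhoff F n x.1)
      ≤ ∑ x : {x : SubshiftX A // shiftMap^[n] x = x}, E * Real.exp (bs ψ n (unwrap n x)) := by
        refine Finset.sum_le_sum fun x _ => ?_
        rw [hE, ← Real.exp_add, Real.exp_le_exp]
        have h1 := abs_le.1 (hF n x.1)
        have h2 := abs_le.1 (bs_agr' hψ hc hθ hθ1 n _ _ (unwrap_agr n x))
        linarith [h1.2, h2.1]
    _ = E * ∑ z ∈ Finset.univ.image (unwrap (A := A) n), Real.exp (bs ψ n z) := by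
        rw [Finset.sum_image (fun a _ b _ h => unwrap_inj hn h), Finset.mul_sum]
    _ ≤ E * ∑ z ∈ Finset.univ.biUnion (fun a : A × Bool => P (cst a)), Real.exp (bs ψ n z) := by
        refine mul_le_mul_of_nonneg_left ?_ (Real.exp_pos _).le
        refine Finset.sum_le_sum_of_subset_of_nonneg ?_ (fun _ _ _ => (Real.exp_pos _).le)
        intro z hz
        obtain ⟨x, _, rfl⟩ := Finset.mem_image.1 hz
        exact Finset.mem_biUnion.2 ⟨_, Finset.mem_univ _, (hP1 _ _).2 (unwrap_sh n x)⟩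
    _ ≤ E * ∑ a : A × Bool, ∑ z ∈ P (cst a), Real.exp (bs ψ n z) := by
        refine mul_le_mul_of_nonneg_left ?_ (Real.exp_pos _).le
        rw [Finset.sum_biUnion]
        intro a _ b _ hab
        refine Finset.disjoint_left.2 fun z hz hz' => hab ?_
        have h1 := (hP1 _ _).1 hz
        rw [(hP1 _ _).1 hz'] at h1
        exact (congrArg (fun y : OS A => y.1 0) h1).symm
    _ ≤ E * ∑ a : A × Bool, R * (T ψ)^[n] (fun _ => 1) y₀ := by
        refine mul_le_mul_of_nonneg_left ?_ (Real.exp_pos _).le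
        refine Finset.sum_le_sum fun a _ => ?_
        rw [← hP2]
        exact hR _ _ _
    _ = _ := by
        rw [Finset.sum_const, nsmul_eq_mul, Finset.card_univ, hE, Real.exp_add]
        ring

open Classical in
lemma part_lower (hA : 2 ≤ Fintype.card A) (hψ : Hol c θ ψ) (hc : 0 ≤ c) (hθ : 0 < θ) (hθ1 : θ < 1)
    (hM : ∀ y, |ψ y| ≤ M)
    {F : SubshiftX A → ℝ} {l K : ℝ} (hF : ∀ n x, |birkhoff F n x - bs ψ n (proj x) - n * l| ≤ K)
    (y₀ : OS A) (n : ℕ) (hn : 0 < n) :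
    Real.exp ((n + 1 : ℕ) * l) * (T ψ)^[n+1] (fun _ => 1) y₀ ≤ 
      Real.exp (K + c / (1 - θ) + M) * (Fintype.card (A × Bool) * Real.exp M * 1) * partitionSum F (n+1) := by
  have := per_finite (A := A) (Nat.succ_pos n)
  have := Fintype.ofFinite {x : SubshiftX A // shiftMap^[n+1] x = x}
  unfold partitionSum
  rw [finsum_eq_sum_of_fintype]
  obtain ⟨P, hP1, hP2⟩ := pre_exists (A := A) (ψ := ψ) n y₀
  choose w hw using wrap_exists hA n hn
  set D : ℝ := Fintype.card (A × Bool) * Real.exp M * 1 with hD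
  have hD0 : 0 ≤ D := by positivity
  have h1 : (T ψ)^[n+1] (fun _ => 1) y₀ ≤ D * (T ψ)^[n] (fun _ => 1) y₀ := by
    rw [Function.iterate_succ_apply]
    have := congrFun (iter_smul (ψ := ψ) D (fun _ => 1) n) y₀
    rw [← this]
    refine iter_mono (fun y => ?_) n y₀
    rw [mul_one]
    exact T_le_sup hM (fun _ => zero_le_one) (fun _ => le_rfl) y
  set E := Real.exp (K + c / (1 - θ) + M) with hE
  have h2 : Real.exp ((n+1 : ℕ) * l) * (T ψ)^[n] (fun _ => 1) y₀ ≤ E * 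
      ∑ x : {x : SubshiftX A // shiftMap^[n+1] x = x}, Real.exp (birkhoff F (n+1) x.1) := by
    rw [hP2]
    calc Real.exp ((n+1 : ℕ) * l) * ∑ z ∈ P, Real.exp (bs ψ n z)
        ≤ ∑ z ∈ P, E * Real.exp (birkhoff F (n+1) (w z).1) := by
          rw [Finset.mul_sum]
          refine Finset.sum_le_sum fun z hz => ?_
          rw [hE, ← Real.exp_add, ← Real.exp_add, Real.exp_le_exp]
          have h1 := abs_le.1 (hF (n+1) (w z).1)
          have h2 := abs_le.1 (bs_agr' hψ hc hθ hθ1 n _ _ (hw z))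
          have h3 : bs ψ (n+1) (proj (w z).1) = bs ψ n (proj (w z).1) + ψ (sh^[n] (proj (w z).1)) := 
            Finset.sum_range_succ _ _
          have h4 := abs_le.1 (hM (sh^[n] (proj (w z).1)))
          linarith [h1.1, h2.1, h4.1]
      _ = E * ∑ x ∈ P.image w, Real.exp (birkhoff F (n+1) x.1) := by
          rw [Finset.sum_image, Finset.mul_sum]
          intro z hz z' hz' hh
          refine Subtype.ext (funext fun i => ?_)
          rcases lt_or_ge i n with hi | hi
          · rw [← hw z i hi, ← hw z' i hi, hh]
          · have e1 := (hP1 z).1 hz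
            have e2 := (hP1 z').1 hz'
            have e3 := sh_iter n z (i - n)
            have e4 := sh_iter n z' (i - n)
            rw [e1, show i - n + n = i by omega] at e3
            rw [e2, show i - n + n = i by omega] at e4
            rw [← e3, ← e4]
      _ ≤ _ := by
          refine mul_le_mul_of_nonneg_left ?_ (Real.exp_pos _).le
          exact Finset.sum_le_sum_of_subset_of_nonneg (Finset.subset_univ _) (fun _ _ _ => (Real.exp_pos _).le)
  calc _ ≤ Real.exp ((n+1 : ℕ) * l) * (D * (T ψ)^[n] (fun _ => 1) y₀) :=
        mul_le_mul_of_nonneg_left h1 (Real.exp_pos _).le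
    _ = D * (Real.exp ((n+1 : ℕ) * l) * (T ψ)^[n] (fun _ => 1) y₀) := by ring
    _ ≤ D * _ := mul_le_mul_of_nonneg_left h2 hD0
    _ = _ := by ring

lemma pressure_of (hA : 2 ≤ Fintype.card A) (hψ : Hol c θ ψ) (hc : 0 ≤ c) (hθ : 0 < θ) (hθ1 : θ < 1)
    (hM : ∀ y, |ψ y| ≤ M)
    {F : SubshiftX A → ℝ} {l K : ℝ} (hF : ∀ n x, |birkhoff F n x - bs ψ n (proj x) - n * l| ≤ K)
    (y₀ : OS A) {q : ℝ}
    (hq : Tendsto (fun n : ℕ => Real.log ((T ψ)^[n] (fun _ => 1) y₀) / n) atTop (𝓝 q)) :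
    pressure F = l + q := by
  obtain ⟨R, hR1, hR⟩ := ratio hA hψ hθ hθ1 hc hM
  have hne : Nonempty A := Fintype.card_pos_iff.1 (by omega)
  have hcard : 0 < (Fintype.card (A × Bool) : ℝ) := by exact_mod_cast Fintype.card_pos
  set D1 := Real.exp (K + c / (1 - θ)) * (Fintype.card (A × Bool) * R) with hD1
  set D2 := Real.exp (K + c / (1 - θ) + M) * (Fintype.card (A × Bool) * Real.exp M * 1) with hD2
  have p1 : 0 < D1 := by positivity
  have p2 : 0 < D2 := by positivity
  have hT : ∀ n, 0 < (T ψ)^[n] (fun _ => 1) y₀ := fun n => iter_pos (fun _ => one_pos) n y₀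
  have key : ∀ n : ℕ, 2 ≤ n → Real.log (partitionSum F n) ≤ Real.log D1 + (n * l + Real.log ((T ψ)^[n] (fun _ => 1) y₀))
      ∧ n * l + Real.log ((T ψ)^[n] (fun _ => 1) y₀) ≤ Real.log D2 + Real.log (partitionSum F n) := by
    intro n hn
    have u := part_upper hψ hc hθ hθ1 hF hR y₀ n (by omega)
    obtain ⟨m, rfl⟩ : ∃ m, n = m + 1 := ⟨n - 1, by omega⟩
    have d := part_lower hA hψ hc hθ hθ1 hM hF y₀ m (by omega)
    have ep := Real.exp_pos ((m+1 : ℕ) * l)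
    have ht := hT (m+1)
    have zp : 0 < partitionSum F (m+1) := by
      have := (mul_pos ep ht).trans_le d
      exact (mul_pos_iff_of_pos_left p2).1 this
    constructor
    · have := Real.log_le_log zp u
      rwa [Real.log_mul p1.ne' (mul_pos ep ht).ne', Real.log_mul ep.ne' ht.ne', Real.log_exp] at this
    · have := Real.log_le_log (mul_pos ep ht) d
      rwa [Real.log_mul p2.ne' zp.ne', Real.log_mul ep.ne' ht.ne', Real.log_exp] at this
  refine Tendsto.limsup_eq ?_
  have ca : ∀ a : ℝ, Tendsto (fun n : ℕ => a / (n : ℝ)) atTop (𝓝 0) := fun a => 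
    tendsto_const_div_atTop_nhds_zero_nat a
  have lo : Tendsto (fun n : ℕ => l + Real.log ((T ψ)^[n] (fun _ => 1) y₀) / n - Real.log D2 / n) atTop (𝓝 (l + q)) := by
    simpa using (hq.const_add l).sub (ca (Real.log D2))
  have hi : Tendsto (fun n : ℕ => l + Real.log ((T ψ)^[n] (fun _ => 1) y₀) / n + Real.log D1 / n) atTop (𝓝 (l + q)) := by
    simpa using (hq.const_add l).add (ca (Real.log D1))
  refine tendsto_of_tendsto_of_tendsto_of_le_of_le' lo hi ?_ ?_
  · filter_upwards [eventually_ge_atTop 2] with n hn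
    have hn0 : (0:ℝ) < n := by exact_mod_cast (by omega : 0 < n)
    rw [le_div_iff₀ hn0, sub_mul, add_mul, div_mul_cancel₀ _ hn0.ne', div_mul_cancel₀ _ hn0.ne']
    linarith [(key n hn).2]
  · filter_upwards [eventually_ge_atTop 2] with n hn
    have hn0 : (0:ℝ) < n := by exact_mod_cast (by omega : 0 < n)
    rw [div_le_iff₀ hn0, add_mul, add_mul, div_mul_cancel₀ _ hn0.ne', div_mul_cancel₀ _ hn0.ne']
    linarith [(key n hn).1]

end OS
end

theorem pressure_analytic_along_line {A : Type*} [Fintype A]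
    (hA : 2 ≤ Fintype.card A)
    (F₁ F₂ : SubshiftX A → ℝ) (h₁ : IsHolder F₁) (h₂ : IsHolder F₂) :
    ∀ t : ℝ, AnalyticAt ℝ (fun s : ℝ => pressure (fun x => F₁ x + s * F₂ x)) t := by
  intro t₀
  obtain ⟨C₁, β₁, hC₁, hβ₁, hβ₁', H₁⟩ := OS.holder_TH h₁
  obtain ⟨C₂, β₂, hC₂, hβ₂, hβ₂', H₂⟩ := OS.holder_TH h₂
  set γ : ℝ := (max β₁ β₂) ^ (1/3 : ℝ) with hγd
  have hm0 : 0 < max β₁ β₂ := lt_max_of_lt_left hβ₁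
  have hγ : 0 < γ := by positivity
  have hγ1 : γ < 1 := Real.rpow_lt_one hm0.le (max_lt hβ₁' hβ₂') (by norm_num)
  have hγ3 : γ ^ 3 = max β₁ β₂ := by
    rw [hγd, ← Real.rpow_natCast, ← Real.rpow_mul hm0.le]; norm_num
  obtain ⟨G₁, c₁, U₁, hc₁, hU₁, K₁, E₁⟩ := OS.sinai (γ := γ)
    (H₁.mono hC₁ hβ₁.le (hγ3 ▸ le_max_left _ _)) hC₁ hγ hγ1
  obtain ⟨G₂, c₂, U₂, hc₂, hU₂, K₂, E₂⟩ := OS.sinai (γ := γ)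
    (H₂.mono hC₂ hβ₂.le (hγ3 ▸ le_max_right _ _)) hC₂ hγ hγ1
  have hne : Nonempty A := Fintype.card_pos_iff.1 (by omega)
  obtain ⟨a₀⟩ := hne
  set y₀ : OS A := OS.cst (a₀, true)
  have Kψ := K₁.add (K₂.smul t₀)
  have hcψ : 0 ≤ c₁ + |t₀| * c₂ := by positivity
  obtain ⟨M, hM0, hM⟩ := Kψ.bdd y₀ hcψ
  obtain ⟨M', hM'0, hM'⟩ := K₂.bdd y₀ hc₂
  obtain ⟨L, v, ψ₀, V, C₀, hψ₀, hV, hC₀, hHol, Λ, hΛ, hsl, r, hr, hlim⟩ :=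
    OS.os_analytic hA Kψ hγ hγ1 hcψ hM hM0 K₂ hM' hM'0 hc₂ y₀
  have hp : ∀ t : ℝ, |t| < r → pressure (fun x => F₁ x + (t₀ + t) * F₂ x) = L + Real.log ‖Λ t‖ := by
    intro t ht
    have Kt := hHol.add (K₂.smul t)
    have hct : 0 ≤ C₀ + |t| * c₂ := by positivity
    obtain ⟨Mt, _, hMt⟩ := Kt.bdd y₀ hct
    refine OS.pressure_of (K := U₁ + |t₀ + t| * U₂ + 2 * V) hA Kt hct hγ hγ1 hMt ?_ y₀ (hlim t ht)
    intro n x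
    have e1 : birkhoff (fun x => F₁ x + (t₀ + t) * F₂ x) n x = birkhoff F₁ n x + (t₀ + t) * birkhoff F₂ n x := by
      unfold birkhoff
      rw [Finset.sum_add_distrib, Finset.mul_sum]
    have e2 : OS.bs (fun y => ψ₀ y + t * G₂ y) n (OS.proj x) = 
        (∑ i ∈ Finset.range n, G₁ (OS.sh^[i] (OS.proj x))) + 
        (t₀ + t) * (∑ i ∈ Finset.range n, G₂ (OS.sh^[i] (OS.proj x))) +
        (v (OS.proj x) - v (OS.sh^[n] (OS.proj x))) - n * L := by
      have := Finset.sum_range_sub' (fun i => v (OS.sh^[i] (OS.proj x))) n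
      simp only [Function.iterate_zero_apply] at this
      rw [← this, Finset.mul_sum, ← Finset.sum_add_distrib, ← Finset.sum_add_distrib]
      have e : (n : ℝ) * L = ∑ i ∈ Finset.range n, L := by simp
      rw [e, ← Finset.sum_sub_distrib]
      unfold OS.bs
      refine Finset.sum_congr rfl fun i _ => ?_
      simp only [hψ₀, Function.iterate_succ_apply']
      ring
    rw [e1, e2]
    have b1 := abs_le.1 (E₁ n x)
    have b2 : |(t₀ + t) * (birkhoff F₂ n x - ∑ i ∈ Finset.range n, G₂ (OS.sh^[i] (OS.proj x)))| ≤ |t₀ + t| * U₂ := by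
      rw [abs_mul]; exact mul_le_mul_of_nonneg_left (E₂ n x) (abs_nonneg _)
    have b2 := abs_le.1 b2
    have b3 := abs_le.1 (hV (OS.proj x))
    have b4 := abs_le.1 (hV (OS.sh^[n] (OS.proj x)))
    rw [abs_le]
    constructor <;> linarith [b1.1, b1.2, b2.1, b2.2, b3.1, b3.2, b4.1, b4.2]
  have hlog : AnalyticAt ℂ (fun z => Complex.log (Λ z)) 0 := hΛ.clog hsl
  have hof : AnalyticAt ℝ (fun s : ℝ => ((s - t₀ : ℝ) : ℂ)) t₀ := 
    (Complex.ofRealCLM.analyticAt _).comp (analyticAt_id.sub analyticAt_const)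
  have h3 : AnalyticAt ℝ (fun s : ℝ => Complex.log (Λ ((s - t₀ : ℝ) : ℂ))) t₀ := by
    refine AnalyticAt.comp (g := fun z => Complex.log (Λ z)) (f := fun s : ℝ => ((s - t₀ : ℝ) : ℂ)) ?_ hof
    simpa using hlog.restrictScalars (𝕜 := ℝ)
  have h4 : AnalyticAt ℝ (fun s : ℝ => L + (Complex.log (Λ ((s - t₀ : ℝ) : ℂ))).re) t₀ :=
    analyticAt_const.add ((Complex.reCLM.analyticAt _).comp h3)
  refine h4.congr ?_
  filter_upwards [Metric.ball_mem_nhds t₀ hr] with s hs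
  rw [Metric.mem_ball, Real.dist_eq] at hs
  have := hp (s - t₀) hs
  rw [show t₀ + (s - t₀) = s by ring] at this
  rw [this, Complex.log_re]
end
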